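/- Let X := ℙ^{n_1} × ⋯ × ℙ^{n_k} with k ≥ 2 and all n_i ≥ 1. Fix (a_1,…,a_k) ∈ ℕ^k with a_i > 0 for all i, and an integer s with 0 < s < ∏_{i=1}^k C(n_i + a_i, n_i) − n_1 − ⋯ − n_k. Let Z ⊂ X be a general subset of cardinality s. Then Z equals the scheme-theoretic base locus of the linear system |I_Z(a_1,…,a_k)|. -/

import Mathlib

/-!
Core framework: a concrete algebraic model of the multiprojective space
`X = ℙ^{n 0} × ⋯ × ℙ^{n (k-1)}` over a field `K`, via its multihomogeneous
coordinate ring `R = K[x_{ij}]`.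
-/

open MvPolynomial Module
open scoped TensorProduct

namespace MultiProjPaper

variable (K : Type) [Field K] (k : ℕ) (n : Fin k → ℕ)

/-- Index type of the variables `x_{ij}`, `i = 1, …, k`, `0 ≤ j ≤ n i`. -/
abbrev MPIdx := Σ i : Fin k, Fin (n i + 1)

/-- The multihomogeneous coordinate ring `R = K[x_{ij}]` of the multiprojective space. -/
abbrev MPR := MvPolynomial (MPIdx k n) K

/-- The weight of the variable `x_{ij}` is the multiindex `ε_i`. -/
def mpWeight : MPIdx k n → (Fin k → ℕ) := fun x => Pi.single x.1 1

/-- The space of multihomogeneous polynomials of multidegree `a`, i.e. `H^0(X, O_X(a))`. -/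
noncomputable def mcomp (a : Fin k → ℕ) : Submodule K (MPR K k n) :=
  weightedHomogeneousSubmodule K (mpWeight k n) a

/-- A (representative of a) point of `X`: a tuple of nonzero vectors. -/
structure MPPoint where
  v : ∀ i : Fin k, Fin (n i + 1) → K
  nz : ∀ i, v i ≠ 0

/-- Evaluation of a polynomial at (a representative of) a point. -/
noncomputable def MPPoint.ev (P : MPPoint K k n) (f : MPR K k n) : K :=
  MvPolynomial.eval (fun x : MPIdx k n => P.v x.1 x.2) f

/-- Evaluation at a scaling (by `lam i` on the `i`-th group of variables) of a point. -/
noncomputable def coneEval (lam : Fin k → K) (P : MPPoint K k n) (f : MPR K k n) : K :=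
  MvPolynomial.eval (fun x : MPIdx k n => lam x.1 * P.v x.1 x.2) f

/-- The (multihomogeneous, saturated) vanishing ideal of a set of points of `X`:
all polynomials vanishing on the affine multicone over the set. -/
noncomputable def vanIdeal (S : Set (MPPoint K k n)) : Ideal (MPR K k n) where
  carrier := {f | ∀ P ∈ S, ∀ lam : Fin k → K, coneEval K k n lam P f = 0}
  add_mem' := by
    intro f g hf hg P hP lam
    simp only [coneEval, map_add] at *
    rw [hf P hP lam, hg P hP lam, add_zero]
  zero_mem' := by intro P hP lam; simp [coneEval]
  smul_mem' := by
    intro c f hf P hP lam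
    simp only [coneEval, smul_eq_mul, map_mul] at *
    rw [hf P hP lam, mul_zero]

/-- `H^0(X, 𝓘(a))` for the sheaf of ideals associated to a multihomogeneous ideal `I`:
the multidegree-`a` component of `I`. -/
noncomputable def secI (I : Ideal (MPR K k n)) (a : Fin k → ℕ) : Submodule K (MPR K k n) :=
  mcomp K k n a ⊓ (Submodule.restrictScalars K I)

/-- `h^0(X, 𝓘(a))`. -/
noncomputable def h0I (I : Ideal (MPR K k n)) (a : Fin k → ℕ) : ℕ :=
  finrank K ↥(secI K k n I a)

/-- A zero-dimensional closed subscheme `Z ⊂ X`, modeled by its saturated multihomogeneous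
ideal `I`, together with its degree (= length) `deg`: the multigraded Hilbert function of
`R/I` is eventually constant, equal to `deg`. -/
structure ZeroDimClosed where
  I : Ideal (MPR K k n)
  homog : ∀ f ∈ I, ∀ a : Fin k → ℕ, weightedHomogeneousComponent (mpWeight k n) a f ∈ I
  saturated : ∀ f : MPR K k n,
    (∀ g : ∀ i : Fin k, Fin (n i + 1), (∏ i : Fin k, X (⟨i, g i⟩ : MPIdx k n)) * f ∈ I) → f ∈ I
  deg : ℕ
  hilb : ∃ d₀ : ℕ, ∀ a : Fin k → ℕ, (∀ i, d₀ ≤ a i) →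
    finrank K ↥(secI K k n I a) + deg = finrank K ↥(mcomp K k n a)

/-- `h^0(X, 𝓘_Z(a))` for a zero-dimensional closed subscheme `Z`. -/
noncomputable def h0Z (Z : ZeroDimClosed K k n) (a : Fin k → ℕ) : ℕ := h0I K k n Z.I a

/-- `h^1(X, 𝓘_Z(a))` for a zero-dimensional closed subscheme `Z` and `a ∈ ℕ^k`:
from the exact sequence `0 → 𝓘_Z(a) → O_X(a) → O_Z(a) → 0` and `h^1(O_X(a)) = 0`,
`h^1(𝓘_Z(a)) = deg Z - (h^0(O_X(a)) - h^0(𝓘_Z(a)))`. -/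
noncomputable def h1Z (Z : ZeroDimClosed K k n) (a : Fin k → ℕ) : ℤ :=
  (Z.deg : ℤ) + (h0Z K k n Z a : ℤ) - (finrank K ↥(mcomp K k n a) : ℤ)

/-- "A general tuple of `s` points of `X` satisfies `P`": there is a nonzero polynomial `F`
in the coordinates of the representative vectors of the `s` points (i.e. a nonempty Zariski
open subset of `X^s`) such that every tuple of points where `F` does not vanish satisfies `P`. -/
def GenericPts (s : ℕ) (P : (Fin s → MPPoint K k n) → Prop) : Prop :=
  ∃ F : MvPolynomial (Fin s × MPIdx k n) K, F ≠ 0 ∧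
    ∀ T : Fin s → MPPoint K k n,
      MvPolynomial.eval (fun q : Fin s × MPIdx k n => (T q.1).v q.2.1 q.2.2) F ≠ 0 → P T

/-- "A general tuple of `d` vectors of the `K`-vector space `V` satisfies `P`":
there is a nonzero polynomial in the coordinates (w.r.t. a fixed basis) of the `d` vectors
such that every tuple where it does not vanish satisfies `P`. -/
def GenericVecs (V : Type) [AddCommGroup V] [Module K V] (d : ℕ)
    (P : (Fin d → V) → Prop) : Prop :=
  ∃ F : MvPolynomial (Fin d × (Basis.ofVectorSpaceIndex K V)) K, F ≠ 0 ∧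
    ∀ w : Fin d → V,
      MvPolynomial.eval
        (fun q : Fin d × (Basis.ofVectorSpaceIndex K V) =>
          (Basis.ofVectorSpace K V).repr (w q.1) q.2) F ≠ 0 → P w

/-- Multiplication `H^0(O_X(c)) ⊗ H^0(𝓘(a)) → H^0(𝓘(a + c))` as a bilinear map. -/
noncomputable def mulSec (I : Ideal (MPR K k n)) (c a : Fin k → ℕ) :
    ↥(mcomp K k n c) →ₗ[K] ↥(secI K k n I a) →ₗ[K] ↥(secI K k n I (a + c)) :=
  LinearMap.mk₂ K
    (fun f g => ⟨(f : MPR K k n) * (g : MPR K k n), by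
      constructor
      · have hf : IsWeightedHomogeneous (mpWeight k n) (f : MPR K k n) c := f.2
        have hg : IsWeightedHomogeneous (mpWeight k n) (g : MPR K k n) a := g.2.1
        have := hf.mul hg
        rw [add_comm c a] at this
        exact this
      · exact Ideal.mul_mem_left _ _ g.2.2⟩)
    (fun f f' g => by apply Subtype.ext; simp [add_mul])
    (fun c' f g => by apply Subtype.ext; simp [smul_eq_mul]; try ring)
    (fun f g g' => by apply Subtype.ext; simp [mul_add])
    (fun c' f g => by apply Subtype.ext; simp [smul_eq_mul]; try ring)

/-- The multiplication map `μ : H^0(O_X(c)) ⊗ H^0(𝓘(a)) → H^0(𝓘(a+c))`. -/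
noncomputable def mulMap (I : Ideal (MPR K k n)) (c a : Fin k → ℕ) :
    (↥(mcomp K k n c) ⊗[K] ↥(secI K k n I a)) →ₗ[K] ↥(secI K k n I (a + c)) :=
  TensorProduct.lift (mulSec K k n I c a)

end MultiProjPaper

namespace MultiProjPaper

variable (K : Type) [Field K] (k : ℕ) (n : Fin k → ℕ)

/-- Saturation of a multihomogeneous ideal with respect to the irrelevant ideal of the
multiprojective space (generated by the products of one variable from each group). -/
noncomputable def msat (J : Ideal (MPR K k n)) : Ideal (MPR K k n) :=
  Ideal.span {f | ∃ N : ℕ, ∀ g : Fin N → ∀ i : Fin k, Fin (n i + 1),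
    (∏ t : Fin N, ∏ i : Fin k, X (⟨i, g t i⟩ : MPIdx k n)) * f ∈ J}

end MultiProjPaper

theorem exists_derivation_extension {A κ : Type*} [CommRing A] [IsDomain A] [CharZero A]
    [Field κ] [Algebra A κ] [FaithfulSMul A κ] [Algebra.EssFiniteType A κ]
    (d : Derivation ℤ A A) :
    ∃ d' : Derivation ℤ κ κ, ∀ a, d' (algebraMap A κ a) = algebraMap A κ (d a) := by
  let := FractionRing.liftAlgebra A κ
  have := FractionRing.isScalarTower_liftAlgebra A κ
  have : CharZero (FractionRing A) := charZero_of_injective_algebraMap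
    (IsFractionRing.injective A (FractionRing A))
  have : Algebra.EssFiniteType (FractionRing A) κ := .of_comp A _ _
  have : Algebra.FormallySmooth A (FractionRing A) := .of_isLocalization (nonZeroDivisors A)
  have : Algebra.FormallySmooth A κ := .comp A (FractionRing A) κ
  let φ : A →+* TrivSqZeroExt κ κ :=
    { toFun := fun a => (algebraMap A κ a, algebraMap A κ (d a))
      map_one' := TrivSqZeroExt.ext (map_one _) (by
        change algebraMap A κ (d 1) = 0
        simp)
      map_mul' := fun x y => TrivSqZeroExt.ext (map_mul _ _ _) (by
        change algebraMap A κ (d (x * y)) = algebraMap A κ x • algebraMap A κ (d y) +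
          MulOpposite.op (algebraMap A κ y) • algebraMap A κ (d x)
        simp [mul_comm])
      map_zero' := TrivSqZeroExt.ext (map_zero _) (by
        change algebraMap A κ (d 0) = 0
        simp)
      map_add' := fun x y => TrivSqZeroExt.ext (map_add _ _ _) (by
        change algebraMap A κ (d (x + y)) = algebraMap A κ (d x) + algebraMap A κ (d y)
        simp) }
  let alg : Algebra A (TrivSqZeroExt κ κ) := φ.toAlgebra
  let π : TrivSqZeroExt κ κ →ₐ[A] κ :=
    { TrivSqZeroExt.fstHom ℤ κ κ with
      commutes' := fun a => by
        rfl }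
  have hπ : Function.Surjective π := fun x => ⟨TrivSqZeroExt.inl x, rfl⟩
  have hn : IsNilpotent (RingHom.ker (π : TrivSqZeroExt κ κ →+* κ)) := by
    refine ⟨2, ?_⟩
    rw [Ideal.zero_eq_bot, eq_bot_iff]
    refine (le_of_eq (pow_two (M := Ideal (TrivSqZeroExt κ κ)) _)).trans
      (Ideal.mul_le.2 fun x hx y hy => ?_)
    have hx' : x.fst = 0 := hx
    have hy' : y.fst = 0 := hy
    rw [Ideal.mem_bot]
    ext <;> simp [hx', hy']
  let σ := Algebra.FormallySmooth.liftOfSurjective (AlgHom.id A κ) π hπ hn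
  have hσ (x : κ) : (σ x).fst = x :=
    Algebra.FormallySmooth.liftOfSurjective_apply (AlgHom.id A κ) π hπ hn x
  refine ⟨Derivation.mk' (((TrivSqZeroExt.sndHom κ κ).toAddMonoidHom.comp
    σ.toRingHom.toAddMonoidHom).toIntLinearMap) fun x y => ?_, fun a => ?_⟩
  · change (σ (x * y)).snd = x • (σ y).snd + y • (σ x).snd
    rw [map_mul, TrivSqZeroExt.snd_mul, hσ, hσ]
    simp [mul_comm]
  · change (σ (algebraMap A κ a)).snd = _
    rw [AlgHom.commutes]
    rfl

namespace MultiProjPaper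

section Monomials

variable {k : ℕ} {n : Fin k → ℕ}

theorem weight_mpWeight_apply (m : MPIdx k n →₀ ℕ) (u : Fin k) :
    Finsupp.weight (mpWeight k n) m u = ∑ j, m ⟨u, j⟩ := by
  rw [Finsupp.weight_eq_sum, Finset.sum_apply, Fintype.sum_sigma, Finset.sum_eq_single u]
  · simp [mpWeight]
  · intro v _ hv
    simp [mpWeight, hv.symm]
  · simp

/-- Exponents of the monomials of multidegree `a`. -/
abbrev MonIdx (n : Fin k → ℕ) (a : Fin k → ℕ) :=
  {m : MPIdx k n →₀ ℕ // Finsupp.weight (mpWeight k n) m = a}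

/-- An exponent of multidegree `a` is a family of exponents, one for each factor. -/
noncomputable def monIdxEquiv (n : Fin k → ℕ) (a : Fin k → ℕ) :
    MonIdx n a ≃ ∀ u, {f : Fin (n u + 1) → ℕ // ∑ j, f j = a u} :=
  ((Finsupp.equivFunOnFinite.trans (Equiv.piCurry fun u (_ : Fin (n u + 1)) => ℕ)).subtypeEquiv
    (q := fun f => ∀ u, ∑ j, f u j = a u) fun m => by
      rw [funext_iff]
      simp only [weight_mpWeight_apply]
      rfl).trans
    (Equiv.subtypePiEquivPi (p := fun u (f : Fin (n u + 1) → ℕ) => ∑ j, f j = a u))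

instance (a : Fin k → ℕ) : Finite (MonIdx n a) := by
  have (u : Fin k) : Finite {f : Fin (n u + 1) → ℕ // ∑ j, f j = a u} :=
    Finite.of_equiv _ (Sym.equivNatSumOfFintype (Fin (n u + 1)) (a u))
  exact Finite.of_equiv _ (monIdxEquiv n a).symm

noncomputable instance (a : Fin k → ℕ) : Fintype (MonIdx n a) := Fintype.ofFinite _

theorem card_monIdx (a : Fin k → ℕ) :
    Fintype.card (MonIdx n a) = ∏ i, Nat.choose (n i + a i) (n i) := by
  rw [← Nat.card_eq_fintype_card, Nat.card_congr (monIdxEquiv n a), Nat.card_pi]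
  refine Finset.prod_congr rfl fun u _ => ?_
  rw [← Nat.card_congr (Sym.equivNatSumOfFintype (Fin (n u + 1)) (a u)),
    Nat.card_eq_fintype_card, Sym.card_sym_eq_choose, Fintype.card_fin,
    show n u + 1 + a u - 1 = n u + a u by omega]
  exact Nat.choose_symm_add.symm

variable {a : Fin k → ℕ} {S S' : Type} [CommRing S] [CommRing S']

/-- The vector of the values at `Q` of the monomials of multidegree `a`. -/
noncomputable def monVec (a : Fin k → ℕ) (Q : MPIdx k n → S) : MonIdx n a → S :=
  fun m => eval Q (monomial m.1 1)

/-- The vector of the values at `Q` of the derivatives with respect to the variable `y` of the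
monomials of multidegree `a`. -/
noncomputable def dmonVec (a : Fin k → ℕ) (Q : MPIdx k n → S) (y : MPIdx k n) : MonIdx n a → S :=
  fun m => eval Q (pderiv y (monomial m.1 1))

theorem monVec_map (φ : S →+* S') (Q : MPIdx k n → S) (m : MonIdx n a) :
    φ (monVec a Q m) = monVec a (φ ∘ Q) m := by
  simp [monVec, eval_monomial, Finsupp.prod]

theorem dmonVec_map (φ : S →+* S') (Q : MPIdx k n → S) (y : MPIdx k n) (m : MonIdx n a) :
    φ (dmonVec a Q y m) = dmonVec a (φ ∘ Q) y m := by
  simp [dmonVec, pderiv_monomial, eval_monomial, Finsupp.prod]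

/-- The indices not belonging to a chart `g`. -/
abbrev OffChart (g : ∀ i, Fin (n i + 1)) := {y : MPIdx k n // y.2 ≠ g y.1}

theorem card_offChart (g : ∀ i, Fin (n i + 1)) : Fintype.card (OffChart g) = ∑ i, n i := by
  let e : OffChart g ≃ Σ u, {j : Fin (n u + 1) // j ≠ g u} :=
    { toFun := fun y => ⟨y.1.1, y.1.2, y.2⟩
      invFun := fun z => ⟨⟨z.1, z.2.1⟩, z.2.2⟩
      left_inv := fun _ => rfl
      right_inv := fun _ => rfl }
  rw [Fintype.card_congr e, Fintype.card_sigma]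
  refine Finset.sum_congr rfl fun u _ => ?_
  rw [Fintype.card_subtype_compl]
  simp

theorem MonIdx.ext_off {m m' : MonIdx n a} (g : ∀ i, Fin (n i + 1))
    (h : ∀ x : MPIdx k n, x.2 ≠ g x.1 → m.1 x = m'.1 x) : m = m' := by
  refine Subtype.ext (Finsupp.ext fun x => ?_)
  by_cases hx : x.2 = g x.1
  · obtain ⟨u, j⟩ := x
    have h1 := congrFun (m.2.trans m'.2.symm) u
    rw [weight_mpWeight_apply, weight_mpWeight_apply, ← Finset.add_sum_erase _ _ (Finset.mem_univ j),
      ← Finset.add_sum_erase _ (fun j => m'.1 ⟨u, j⟩) (Finset.mem_univ j),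
      Finset.sum_congr rfl (g := fun j => m'.1 ⟨u, j⟩) fun j' hj' => h ⟨u, j'⟩ fun h' =>
        (Finset.ne_of_mem_erase hj') (h'.trans hx.symm)] at h1
    exact Nat.add_right_cancel h1
  · exact h x hx

/-- The exponent of multidegree `a` obtained from `d` by adding variables of the chart `g`. -/
noncomputable def stdIdx (a : Fin k → ℕ) (g : ∀ i, Fin (n i + 1)) (d : MPIdx k n →₀ ℕ)
    (hd : Finsupp.weight (mpWeight k n) d ≤ a) : MonIdx n a :=
  ⟨∑ u, Finsupp.single ⟨u, g u⟩ (a u - Finsupp.weight (mpWeight k n) d u) + d, by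
    ext v
    simp only [map_add, map_sum, Finsupp.weight_single, Pi.add_apply, Finset.sum_apply]
    simp only [mpWeight, Pi.smul_apply, Pi.single_apply, smul_eq_mul, mul_ite, mul_one, mul_zero,
      Finset.sum_ite_eq, Finset.mem_univ, if_true]
    exact Nat.sub_add_cancel (hd v)⟩

theorem stdIdx_off (g : ∀ i, Fin (n i + 1)) (d : MPIdx k n →₀ ℕ)
    (hd : Finsupp.weight (mpWeight k n) d ≤ a) {x : MPIdx k n} (hx : x.2 ≠ g x.1) :
    (stdIdx a g d hd).1 x = d x := by
  simp only [stdIdx, Finsupp.add_apply, Finsupp.finsetSum_apply]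
  rw [Finset.sum_eq_zero, zero_add]
  intro u _
  rw [Finsupp.single_apply, if_neg]
  rintro rfl
  exact hx rfl

theorem stdIdx_on (g : ∀ i, Fin (n i + 1)) (d : MPIdx k n →₀ ℕ)
    (hd : Finsupp.weight (mpWeight k n) d ≤ a) (u : Fin k) :
    (stdIdx a g d hd).1 ⟨u, g u⟩ = a u - Finsupp.weight (mpWeight k n) d u + d ⟨u, g u⟩ := by
  simp only [stdIdx, Finsupp.add_apply, Finsupp.finsetSum_apply]
  rw [Finset.sum_eq_single u]
  · simp
  · intro v _ hv
    rw [Finsupp.single_apply, if_neg]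
    rintro h
    exact hv (congrArg Sigma.fst h)
  · simp

theorem weight_single_le (ha : ∀ i, 0 < a i) (y : MPIdx k n) :
    Finsupp.weight (mpWeight k n) (Finsupp.single y 1) ≤ a := by
  intro v
  rw [Finsupp.weight_single, one_smul, mpWeight, Pi.single_apply]
  split_ifs
  exacts [ha v, Nat.zero_le _]

/-- The coordinate point of the chart `g`. -/
def coordPt (S : Type) [CommRing S] (g : ∀ i, Fin (n i + 1)) : MPIdx k n → S :=
  fun x => if x.2 = g x.1 then 1 else 0

theorem prod_coordPt (g : ∀ i, Fin (n i + 1)) (m : MPIdx k n →₀ ℕ) :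
    (m.prod fun x e => coordPt S g x ^ e) =
      if ∀ x : MPIdx k n, x.2 ≠ g x.1 → m x = 0 then 1 else 0 := by
  rw [Finsupp.prod_fintype _ _ (by simp)]
  split_ifs with h
  · refine Finset.prod_eq_one fun x _ => ?_
    by_cases hx : x.2 = g x.1
    · simp [coordPt, hx]
    · simp [h x hx]
  · push Not at h
    obtain ⟨x, hx, hm⟩ := h
    exact Finset.prod_eq_zero (Finset.mem_univ x) (by simp [coordPt, hx, hm])

theorem monVec_coordPt (g : ∀ i, Fin (n i + 1)) :
    monVec a (coordPt S g) = Pi.single (stdIdx a g 0 (by simp)) 1 := by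
  ext m
  rw [monVec, eval_monomial, prod_coordPt, one_mul, Pi.single_apply]
  refine if_congr ⟨fun h => MonIdx.ext_off g fun x hx => ?_, fun h x hx => ?_⟩ rfl rfl
  · rw [h x hx, stdIdx_off _ _ _ hx]
    rfl
  · rw [h, stdIdx_off _ _ _ hx]
    rfl

theorem dmonVec_coordPt (ha : ∀ i, 0 < a i) (g : ∀ i, Fin (n i + 1)) {y : MPIdx k n}
    (hy : y.2 ≠ g y.1) : dmonVec a (coordPt S g) y =
      Pi.single (stdIdx a g (Finsupp.single y 1) (weight_single_le ha y)) 1 := by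
  ext m
  rw [dmonVec, pderiv_monomial, eval_monomial, prod_coordPt, one_mul, Pi.single_apply]
  by_cases h : m = stdIdx a g (Finsupp.single y 1) (weight_single_le ha y)
  · rw [if_pos h, h, stdIdx_off _ _ _ hy, if_pos]
    · simp
    · intro x hx
      rw [Finsupp.tsub_apply, stdIdx_off _ _ _ hx, Nat.sub_self]
  · rw [if_neg h]
    split_ifs with h'
    · suffices m.1 y = 0 by simp [this]
      by_contra hm
      refine h (MonIdx.ext_off g fun x hx => ?_)
      have := h' x hx
      rw [stdIdx_off _ _ _ hx]
      rw [Finsupp.tsub_apply] at this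
      by_cases hxy : y = x
      · subst hxy
        have h1 := h' y hx
        simp only [Finsupp.tsub_apply, Finsupp.single_eq_same] at h1 ⊢
        omega
      · simpa [Finsupp.single_apply, hxy] using this
    · simp

end Monomials

section LinearAlgebra

theorem exists_dual_family {F J M : Type} [Field F] [Fintype J] [DecidableEq J] [Fintype M]
    {V : J → M → F} (hV : LinearIndependent F V) :
    ∃ C : M → J → F, ∀ j j', ∑ m, V j m * C m j' = if j = j' then 1 else 0 := by
  classical
  obtain ⟨L, hL⟩ := LinearMap.exists_leftInverse_of_injective (Fintype.linearCombination F V)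
    (LinearMap.ker_eq_bot.2 hV.fintypeLinearCombination_injective)
  refine ⟨fun m j => L (Pi.single m 1) j, fun j j' => ?_⟩
  have h1 : L (V j) = Pi.single j 1 := by
    have := LinearMap.congr_fun hL (Pi.single j 1)
    simpa [Fintype.linearCombination_apply_single] using this
  have h2 : L (V j) = ∑ m, V j m • L (Pi.single m 1) := by
    conv_lhs => rw [pi_eq_sum_univ' (V j)]
    simp [map_sum]
  rw [h1] at h2
  have h3 := congrFun h2 j'
  simp only [Finset.sum_apply, Pi.smul_apply, smul_eq_mul] at h3
  rw [← h3, Pi.single_apply]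
  simp [eq_comm]

/-- A family of vectors over a domain whose specialization is independent has a dual family up to
a nonzero factor. -/
theorem exists_dual_family_of_specialization {F A J M : Type} [Field F] [CommRing A]
    [Algebra F A] [Fintype J] [DecidableEq J] [Fintype M] (φ : A →ₐ[F] F) {V : J → M → A}
    (hV : LinearIndependent F fun j m => φ (V j m)) :
    ∃ Δ : A, Δ ≠ 0 ∧ ∃ C : M → J → A,
      ∀ j j', ∑ m, V j m * C m j' = if j = j' then Δ else 0 := by
  obtain ⟨C, hC⟩ := exists_dual_family hV
  let G : Matrix J J A := Matrix.of V * Matrix.of fun m j => algebraMap F A (C m j)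
  refine ⟨G.det, fun h => ?_, Matrix.of (fun m j => algebraMap F A (C m j)) * G.adjugate,
    fun j j' => ?_⟩
  · have h1 : G.map φ = 1 := by
      ext j j'
      simp [G, Matrix.mul_apply, hC, Matrix.one_apply]
    have h2 := congrArg φ h
    rw [AlgHom.map_det, map_zero] at h2
    change (G.map φ).det = 0 at h2
    rw [h1, Matrix.det_one] at h2
    exact one_ne_zero h2
  · have h1 : Matrix.of V * (Matrix.of (fun m j => algebraMap F A (C m j)) * G.adjugate) =
        G.det • (1 : Matrix J J A) := by
      rw [← Matrix.mul_assoc, Matrix.mul_adjugate]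
    have h2 := congrFun (congrFun h1 j) j'
    rw [Matrix.mul_apply] at h2
    simpa [Matrix.one_apply] using h2

theorem linearIndependent_of_dual_family {κ J M : Type} [Field κ] [Fintype J] [DecidableEq J]
    [Fintype M] {V : J → M → κ} {C : M → J → κ} {Δ : κ} (hΔ : Δ ≠ 0)
    (h : ∀ j j', ∑ m, V j m * C m j' = if j = j' then Δ else 0) : LinearIndependent κ V := by
  rw [Fintype.linearIndependent_iff]
  intro c hc j'
  have h1 : ∑ j, c j * ∑ m, V j m * C m j' = 0 := by
    simp only [Finset.mul_sum]
    rw [Finset.sum_comm]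
    refine Finset.sum_eq_zero fun m _ => ?_
    have := congrFun hc m
    simp only [Finset.sum_apply, Pi.smul_apply, smul_eq_mul, Pi.zero_apply] at this
    simp only [← mul_assoc]
    rw [← Finset.sum_mul, this, zero_mul]
  simpa [h, hΔ] using h1

end LinearAlgebra

section Extension

variable {k : ℕ} {n : Fin k → ℕ} {a : Fin k → ℕ} {F : Type} [Field F] [Infinite F]

theorem exists_monVec_notMem {W : Submodule F (MonIdx n a → F)} (hW : W < ⊤) :
    ∃ Q : MPIdx k n → F, monVec a Q ∉ W := by
  classical
  obtain ⟨f, hf, hle⟩ := Submodule.exists_le_ker_of_lt_top W hW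
  by_contra! hQ
  let p : MvPolynomial (MPIdx k n) F := ∑ m : MonIdx n a, monomial m.1 (f (Pi.single m 1))
  have hp : p = 0 := by
    refine MvPolynomial.funext fun Q => ?_
    have h1 : f (monVec a Q) = 0 := hle (hQ Q)
    rw [pi_eq_sum_univ' (monVec a Q), map_sum] at h1
    rw [map_zero, ← h1, map_sum]
    refine Finset.sum_congr rfl fun m _ => ?_
    simp [monVec, eval_monomial, mul_comm]
  apply hf
  refine LinearMap.pi_ext' fun m => LinearMap.ext_ring ?_
  have h2 := congrArg (coeff m.1) hp
  simp only [p, coeff_sum, coeff_monomial, coeff_zero] at h2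
  rw [Finset.sum_eq_single m] at h2
  · simpa using h2
  · intro m' _ hm'
    rw [if_neg]
    exact fun h => hm' (Subtype.ext h)
  · simp

theorem exists_linearIndependent_extension {Y : Type} [Fintype Y] {s : ℕ}
    (b : Y → MonIdx n a → F) (T₀ : Fin s → MPIdx k n → F) (I₀ : Finset (Fin s))
    (h : LinearIndependent F (Sum.elim b fun l : I₀ => monVec a (T₀ l)))
    (hcard : Fintype.card Y + s ≤ Fintype.card (MonIdx n a)) :
    ∃ T : Fin s → MPIdx k n → F, (∀ l ∈ I₀, T l = T₀ l) ∧
      LinearIndependent F (Sum.elim b fun l => monVec a (T l)) := by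
  classical
  let D (I : Finset (Fin s)) : Set (Y ⊕ Fin s) := Set.range Sum.inl ∪ Sum.inr '' (I : Set (Fin s))
  have key (I : Finset (Fin s)) : ∃ T : Fin s → MPIdx k n → F, (∀ l ∈ I₀, T l = T₀ l) ∧
      LinearIndepOn F (Sum.elim b fun l => monVec a (T l)) (D (I₀ ∪ I)) := by
    induction I using Finset.induction_on with
    | empty =>
      refine ⟨T₀, fun _ _ => rfl, ?_⟩
      rw [Finset.union_empty]
      let e : D I₀ → Y ⊕ I₀ := fun x => match x with
        | ⟨Sum.inl y, _⟩ => Sum.inl y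
        | ⟨Sum.inr l, hl⟩ => Sum.inr ⟨l, by simpa [D] using hl⟩
      have he : Function.Injective e := by
        rintro ⟨x | x, hx⟩ ⟨y | y, hy⟩ hxy <;> simp_all [e]
      have := h.comp e he
      rw [LinearIndepOn]
      convert this using 1
      ext ⟨x | x, hx⟩ <;> rfl
    | insert l I hl ih =>
      obtain ⟨T, hT, hli⟩ := ih
      by_cases hl' : l ∈ I₀ ∪ I
      · refine ⟨T, hT, ?_⟩
        rwa [Finset.union_insert, Finset.insert_eq_of_mem hl']
      have hspan : Submodule.span F ((Sum.elim b fun l => monVec a (T l)) '' D (I₀ ∪ I)) < ⊤ := by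
        rw [lt_top_iff_ne_top]
        intro htop
        have h1 := finrank_span_finset_le_card (R := F)
          ((D (I₀ ∪ I)).toFinset.image (Sum.elim b fun l => monVec a (T l)))
        rw [Set.finrank, Finset.coe_image, Set.coe_toFinset, htop, finrank_top,
          finrank_fintype_fun_eq_card] at h1
        have h2 : (D (I₀ ∪ I)).toFinset.card < Fintype.card (Y ⊕ Fin s) := by
          rw [Finset.card_lt_iff_ne_univ, Ne, Finset.eq_univ_iff_forall, not_forall]
          exact ⟨Sum.inr l, by simpa [D] using hl'⟩
        rw [Fintype.card_sum, Fintype.card_fin] at h2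
        have h3 := Finset.card_image_le (s := (D (I₀ ∪ I)).toFinset)
          (f := Sum.elim b fun l => monVec a (T l))
        omega
      obtain ⟨Q, hQ⟩ := exists_monVec_notMem hspan
      have hcongr : Set.EqOn (Sum.elim b fun l' => monVec a (Function.update T l Q l'))
          (Sum.elim b fun l => monVec a (T l)) (D (I₀ ∪ I)) := by
        rintro (x | x) hx
        · rfl
        · have : x ≠ l := by
            rintro rfl
            exact hl' (by simpa [D] using hx)
          simp [Function.update_of_ne this]
      refine ⟨Function.update T l Q, fun l' hl₀ => ?_, ?_⟩
      · rw [Function.update_of_ne, hT l' hl₀]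
        rintro rfl
        exact hl' (Finset.mem_union_left _ hl₀)
      · have hD : D (I₀ ∪ insert l I) = insert (Sum.inr l) (D (I₀ ∪ I)) := by
          rw [Finset.union_insert]
          simp [D, Set.image_insert_eq, Set.union_insert]
        rw [hD, linearIndepOn_insert (by simpa [D] using hl')]
        refine ⟨(linearIndepOn_congr hcongr).2 hli, ?_⟩
        rw [Set.EqOn.image_eq hcongr]
        simpa using hQ
  obtain ⟨T, hT, hli⟩ := key Finset.univ
  refine ⟨T, hT, ?_⟩
  have hD : D (I₀ ∪ Finset.univ) = Set.univ := by
    ext (x | x) <;> simp [D]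
  rwa [hD, linearIndepOn_univ_iff] at hli

end Extension

section Independence

theorem linearIndependent_single {F J M : Type} [Field F] [Finite M] [DecidableEq M] {c : J → M}
    (hc : Function.Injective c) {V : J → M → F} (hV : ∀ j, V j = Pi.single (c j) 1) :
    LinearIndependent F V := by
  have := (Pi.basisFun F M).linearIndependent.comp c hc
  convert this using 1
  ext j : 1
  simp [hV]

variable {k : ℕ} {n : Fin k → ℕ} {a : Fin k → ℕ} {F : Type} [Field F] [Infinite F] {s : ℕ}

/-- There are `s` points whose monomial vectors are independent together with the tangent
directions at one of them. -/
theorem exists_linearIndependent_tangent (ha : ∀ i, 0 < a i)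
    (hs : s + ∑ i, n i < ∏ i, Nat.choose (n i + a i) (n i)) (g : ∀ i, Fin (n i + 1)) (i : Fin s) :
    ∃ T : Fin s → MPIdx k n → F, LinearIndependent F
      (Sum.elim (fun y : OffChart g => dmonVec a (T i) y.1) fun l => monVec a (T l)) := by
  classical
  obtain ⟨T, hT, hli⟩ := exists_linearIndependent_extension (a := a)
    (fun y : OffChart g => dmonVec a (coordPt F g) y.1) (fun _ => coordPt F g) {i} (by
      refine linearIndependent_single (c := Sum.elim
        (fun y : OffChart g => stdIdx a g (Finsupp.single y.1 1) (weight_single_le ha y.1))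
        fun _ => stdIdx a g 0 (by simp)) ?_ ?_
      · have hoff (y z : OffChart g) : (stdIdx a g (Finsupp.single y.1 1)
            (weight_single_le ha y.1)).1 z.1 = if y = z then 1 else 0 := by
          rw [stdIdx_off _ _ _ z.2, Finsupp.single_apply]
          simp [Subtype.ext_iff]
        have hoff0 (z : OffChart g) : (stdIdx a g 0 (by simp)).1 z.1 = 0 := by
          rw [stdIdx_off _ _ _ z.2]
          rfl
        rintro (y | y) (z | z) h
        · have := hoff y z
          simp only [Sum.elim_inl] at h
          rw [h, hoff z z] at this
          simpa [eq_comm] using this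
        · have := hoff y y
          simp only [Sum.elim_inl, Sum.elim_inr] at h
          rw [h, hoff0] at this
          simp at this
        · have := hoff z z
          simp only [Sum.elim_inl, Sum.elim_inr] at h
          rw [← h, hoff0] at this
          simp at this
        · rw [Subsingleton.elim y z]
      · rintro (y | y)
        · exact dmonVec_coordPt ha g y.2
        · exact monVec_coordPt g) (by
      rw [card_offChart, card_monIdx]
      omega)
  have hi : T i = coordPt F g := hT i (Finset.mem_singleton_self i)
  refine ⟨T, ?_⟩
  rwa [hi]

/-- The degree of an exponent in the variables outside a chart. -/
def offDeg (g : ∀ i, Fin (n i + 1)) (m : MonIdx n a) : ℕ := ∑ z : OffChart g, m.1 z.1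

theorem offDeg_stdIdx_zero (g : ∀ i, Fin (n i + 1)) : offDeg g (stdIdx a g 0 (by simp)) = 0 :=
  Finset.sum_eq_zero fun z _ => stdIdx_off g 0 _ z.2

theorem offDeg_stdIdx_single (ha : ∀ i, 0 < a i) (g : ∀ i, Fin (n i + 1)) (y : OffChart g) :
    offDeg g (stdIdx a g (Finsupp.single y.1 1) (weight_single_le ha y.1)) = 1 := by
  classical
  rw [offDeg, Finset.sum_congr rfl fun z _ => stdIdx_off g _ _ z.2]
  simp [Finsupp.single_apply, Subtype.coe_inj]

theorem le_offDeg (g : ∀ i, Fin (n i + 1)) (m : MonIdx n a) {z : MPIdx k n} (hz : z.2 ≠ g z.1) :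
    m.1 z ≤ offDeg g m :=
  Finset.single_le_sum (f := fun z : OffChart g => m.1 z.1) (fun _ _ => Nat.zero_le _)
    (Finset.mem_univ ⟨z, hz⟩)

theorem add_le_offDeg (g : ∀ i, Fin (n i + 1)) (m : MonIdx n a) {z z' : MPIdx k n}
    (hz : z.2 ≠ g z.1) (hz' : z'.2 ≠ g z'.1) (h : z ≠ z') : m.1 z + m.1 z' ≤ offDeg g m := by
  classical
  have h1 := Finset.sum_le_sum_of_subset (f := fun z : OffChart g => m.1 z.1)
    (Finset.subset_univ {⟨z, hz⟩, ⟨z', hz'⟩})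
  rwa [Finset.sum_pair (by simpa using h)] at h1

theorem two_le_offDeg_zero (hk : 2 ≤ k) (ha : ∀ i, 0 < a i) {g g' : ∀ i, Fin (n i + 1)}
    (hg : ∀ i, g' i ≠ g i) : 2 ≤ offDeg g (stdIdx a g' 0 (by simp)) := by
  have hon (u : Fin k) : 1 ≤ (stdIdx a g' 0 (by simp)).1 ⟨u, g' u⟩ := by
    rw [stdIdx_on]
    simp only [map_zero, Pi.zero_apply, Finsupp.coe_zero, tsub_zero, add_zero]
    exact ha u
  have := add_le_offDeg g (stdIdx a g' 0 (by simp)) (z := ⟨⟨0, by omega⟩, g' _⟩)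
    (z' := ⟨⟨1, by omega⟩, g' _⟩) (hg _) (hg _) (by simp)
  have h0 := hon ⟨0, by omega⟩
  have h1 := hon ⟨1, by omega⟩
  omega

theorem exists_two_le_offDeg_single (hk : 2 ≤ k) (hn : ∀ i, 1 ≤ n i) (ha : ∀ i, 0 < a i)
    (hs2 : 2 ≤ s) (hs : s + ∑ i, n i < ∏ i, Nat.choose (n i + a i) (n i))
    {g g' : ∀ i, Fin (n i + 1)} (hg : ∀ i, g' i ≠ g i) :
    ∃ x : MPIdx k n, x.2 ≠ g' x.1 ∧
      2 ≤ offDeg g (stdIdx a g' (Finsupp.single x 1) (weight_single_le ha x)) := by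
  classical
  have hon (x : MPIdx k n) (hx : x.2 ≠ g' x.1) (u : Fin k) (hu : u ≠ x.1) :
      (stdIdx a g' (Finsupp.single x 1) (weight_single_le ha x)).1 ⟨u, g' u⟩ = a u := by
    rw [stdIdx_on, Finsupp.weight_single, one_smul, mpWeight, Pi.single_apply, if_neg hu,
      Finsupp.single_apply, if_neg, add_zero, tsub_zero]
    rintro rfl
    exact hu rfl
  have : Nontrivial (Fin k) := Fin.nontrivial_iff_two_le.2 hk
  by_cases h2 : ∃ u, 2 ≤ a u
  · obtain ⟨u, hu⟩ := h2
    obtain ⟨u', hu'⟩ := exists_ne u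
    refine ⟨⟨u', g u'⟩, (hg u').symm, hu.trans ?_⟩
    rw [← hon ⟨u', g u'⟩ (hg u').symm u hu'.symm]
    exact le_offDeg g _ (hg u)
  have ha1 (u : Fin k) : a u = 1 := by
    have := ha u
    have := not_exists.1 h2 u
    omega
  by_cases hn2 : ∃ u, 2 ≤ n u
  · obtain ⟨u, hu⟩ := hn2
    obtain ⟨u', hu'⟩ := exists_ne u
    obtain ⟨j, hj⟩ : ∃ j, j ∉ ({g u, g' u} : Finset (Fin (n u + 1))) := by
      by_contra! h
      have h1 := Finset.card_le_two (a := g u) (b := g' u)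
      rw [Finset.eq_univ_iff_forall.2 h, Finset.card_univ, Fintype.card_fin] at h1
      omega
    simp only [Finset.mem_insert, Finset.mem_singleton, not_or] at hj
    refine ⟨⟨u, j⟩, hj.2, ?_⟩
    have h1 := add_le_offDeg g (stdIdx a g' (Finsupp.single ⟨u, j⟩ 1) (weight_single_le ha _))
      (z := ⟨u, j⟩) (z' := ⟨u', g' u'⟩) hj.1 (hg u') (by
        rintro h
        exact hu' (congrArg Sigma.fst h).symm)
    rw [stdIdx_off _ _ _ (x := ⟨u, j⟩) hj.2, Finsupp.single_eq_same,
      hon ⟨u, j⟩ hj.2 u' hu', ha1] at h1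
    exact h1
  have hn1 (u : Fin k) : n u = 1 := by
    have := hn u
    have := not_exists.1 hn2 u
    omega
  have hk3 : 3 ≤ k := by
    by_contra h
    obtain rfl : k = 2 := by omega
    simp [hn1, ha1] at hs
    omega
  refine ⟨⟨⟨0, by omega⟩, g _⟩, (hg _).symm, ?_⟩
  have h1 := add_le_offDeg g (stdIdx a g' (Finsupp.single ⟨⟨0, by omega⟩, g _⟩ 1)
    (weight_single_le ha _)) (z := ⟨⟨1, by omega⟩, g' _⟩)
    (z' := ⟨⟨2, by omega⟩, g' _⟩) (hg _) (hg _) (by simp)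
  rw [hon _ (hg _).symm _ (by simp), hon _ (hg _).symm _ (by simp), ha1, ha1] at h1
  exact h1

/-- There are `s` points whose monomial vectors are independent together with the tangent
directions at one of them and one tangent direction at another one. -/
theorem exists_linearIndependent_two_tangents (hk : 2 ≤ k) (hn : ∀ i, 1 ≤ n i)
    (ha : ∀ i, 0 < a i) (hs : s + ∑ i, n i < ∏ i, Nat.choose (n i + a i) (n i))
    (g : ∀ i, Fin (n i + 1)) {i i' : Fin s} (hii : i ≠ i') :
    ∃ (x : MPIdx k n) (T : Fin s → MPIdx k n → F), LinearIndependent F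
      (Sum.elim (fun o : Option (OffChart g) => o.elim (dmonVec a (T i') x)
        fun y => dmonVec a (T i) y.1) fun l => monVec a (T l)) := by
  classical
  have hs2 : 2 ≤ s := Fin.nontrivial_iff_two_le.1 ⟨i, i', hii⟩
  have (u : Fin k) : Nontrivial (Fin (n u + 1)) :=
    Fin.nontrivial_iff_two_le.2 (by have := hn u; omega)
  choose g' hg using fun u => exists_ne (g u)
  obtain ⟨x, hx, hx2⟩ := exists_two_le_offDeg_single hk hn ha hs2 hs hg
  have h0 := two_le_offDeg_zero hk ha hg
  obtain ⟨T, hT, hli⟩ := exists_linearIndependent_extension (a := a)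
    (fun o : Option (OffChart g) => o.elim (dmonVec a (coordPt F g') x)
      fun y => dmonVec a (coordPt F g) y.1)
    (fun l => if l = i then coordPt F g else coordPt F g') {i, i'} (by
      refine linearIndependent_single (c := Sum.elim
        (fun o : Option (OffChart g) =>
          o.elim (stdIdx a g' (Finsupp.single x 1) (weight_single_le ha x))
            fun y => stdIdx a g (Finsupp.single y.1 1) (weight_single_le ha y.1))
        fun l => if l.1 = i then stdIdx a g 0 (by simp) else stdIdx a g' 0 (by simp)) ?_ ?_
      · have hoff (y z : OffChart g) : (stdIdx a g (Finsupp.single y.1 1)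
            (weight_single_le ha y.1)).1 z.1 = if y = z then 1 else 0 := by
          rw [stdIdx_off _ _ _ z.2, Finsupp.single_apply]
          simp [Subtype.ext_iff]
        have hxx : stdIdx a g' (Finsupp.single x 1) (weight_single_le ha x) ≠
            stdIdx a g' 0 (by simp) := fun h => by
          have := congrArg (fun m => m.1 x) h
          simp [stdIdx_off _ _ _ hx] at this
        have hz := offDeg_stdIdx_zero (a := a) g
        have hsg := offDeg_stdIdx_single ha g
        have hmem (l : ({i, i'} : Finset (Fin s))) (hl : l.1 ≠ i) : l.1 = i' := by
          have := l.2
          simp only [Finset.mem_insert, Finset.mem_singleton] at this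
          tauto
        have inj0 (l l' : ({i, i'} : Finset (Fin s)))
            (h : (if l.1 = i then stdIdx a g 0 (by simp) else stdIdx a g' 0 (by simp)) =
              (if l'.1 = i then stdIdx a g 0 (by simp) else stdIdx a g' 0 (by simp))) :
              l = l' := by
          split_ifs at h with h1 h2 h2
          · exact Subtype.ext (h1.trans h2.symm)
          · rw [← h, hz] at h0
            omega
          · rw [h, hz] at h0
            omega
          · exact Subtype.ext ((hmem _ h1).trans (hmem _ h2).symm)
        have cross (o : Option (OffChart g)) (l : ({i, i'} : Finset (Fin s))) :
            o.elim (stdIdx a g' (Finsupp.single x 1) (weight_single_le ha x))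
              (fun y => stdIdx a g (Finsupp.single y.1 1) (weight_single_le ha y.1)) ≠
            if l.1 = i then stdIdx a g 0 (by simp) else stdIdx a g' 0 (by simp) := by
          intro h
          rcases o with _ | y <;> simp only [Option.elim] at h <;> split_ifs at h
          · rw [h, hz] at hx2
            omega
          · exact hxx h
          · have := hsg y
            rw [h, hz] at this
            omega
          · have := hsg y
            rw [h] at this
            omega
        rintro (y | y) (z | z) h
        · rcases y with _ | y <;> rcases z with _ | z <;>
            simp only [Sum.elim_inl, Option.elim] at h
          · rfl
          · rw [h, hsg] at hx2
            omega
          · rw [← h, hsg] at hx2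
            omega
          · have := hoff y z
            rw [h, hoff z z] at this
            obtain rfl : y = z := by simpa using this
            rfl
        · exact (cross _ _ h).elim
        · exact (cross _ _ h.symm).elim
        · rw [inj0 y z h]
      · rintro ((_ | y) | l)
        · exact dmonVec_coordPt ha g' hx
        · exact dmonVec_coordPt ha g y.2
        · simp only [Sum.elim_inr]
          split_ifs
          exacts [monVec_coordPt g, monVec_coordPt g']) (by
      rw [Fintype.card_option, card_offChart, card_monIdx]
      omega)
  have hi : T i = coordPt F g := by
    simpa using hT i (by simp)
  have hi' : T i' = coordPt F g' := by
    simpa [hii.symm] using hT i' (by simp)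
  refine ⟨x, T, ?_⟩
  rwa [hi, hi']

end Independence

section Homogeneous

variable {k : ℕ} {n : Fin k → ℕ} {a : Fin k → ℕ} {A B : Type} [CommRing A] [CommRing B]
  [Algebra A B]

theorem prod_pow_eq_of_weight (c : Fin k → B) {m : MPIdx k n →₀ ℕ}
    (hm : Finsupp.weight (mpWeight k n) m = a) : ∏ x, c x.1 ^ m x = ∏ u, c u ^ a u := by
  rw [Fintype.prod_sigma]
  refine Finset.prod_congr rfl fun u _ => ?_
  rw [← hm, weight_mpWeight_apply, ← Finset.prod_pow_eq_pow_sum]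

theorem aeval_scale (c : Fin k → B) (z : MPIdx k n → B) {w : MvPolynomial (MPIdx k n) A}
    (hw : IsWeightedHomogeneous (mpWeight k n) w a) :
    aeval (fun x => c x.1 * z x) w = (∏ u, c u ^ a u) * aeval z w := by
  rw [aeval_def, aeval_def, eval₂_eq', eval₂_eq', Finset.mul_sum]
  refine Finset.sum_congr rfl fun m hm => ?_
  simp only [mul_pow, Finset.prod_mul_distrib]
  rw [prod_pow_eq_of_weight c (hw (mem_support_iff.1 hm))]
  ring

theorem dmonVec_scale (c : Fin k → A) (Q : MPIdx k n → A) (y : MPIdx k n) (m : MonIdx n a) :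
    c y.1 * dmonVec a (fun x => c x.1 * Q x) y m = (∏ u, c u ^ a u) * dmonVec a Q y m := by
  simp only [dmonVec, pderiv_monomial, eval_monomial, one_mul]
  by_cases h : m.1 y = 0
  · simp [h]
  have hm : m.1 - Finsupp.single y 1 + Finsupp.single y 1 = m.1 :=
    tsub_add_cancel_of_le (Finsupp.single_le_iff.2 (Nat.pos_of_ne_zero h))
  rw [← prod_pow_eq_of_weight c m.2, show ∏ x, c x.1 ^ m.1 x =
    ∏ x, c x.1 ^ (m.1 - Finsupp.single y 1 + Finsupp.single y 1 : MPIdx k n →₀ ℕ) x by rw [hm]]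
  rw [Finsupp.prod_fintype _ _ (by simp), Finsupp.prod_fintype _ _ (by simp)]
  simp only [mul_pow, Finset.prod_mul_distrib, Finsupp.add_apply, pow_add]
  have : ∏ x, c x.1 ^ (Finsupp.single y 1 : MPIdx k n →₀ ℕ) x = c y.1 := by
    rw [Finset.prod_eq_single y]
    · simp
    · intro x _ hx
      simp [hx]
    · simp
  rw [this]
  ring

theorem sum_mul_dmonVec (Q : MPIdx k n → A) (u : Fin k) (m : MonIdx n a) :
    ∑ j, Q ⟨u, j⟩ * dmonVec a Q ⟨u, j⟩ m = (a u : A) * monVec a Q m := by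
  have h (j : Fin (n u + 1)) : Q ⟨u, j⟩ * dmonVec a Q ⟨u, j⟩ m = (m.1 ⟨u, j⟩ : A) * monVec a Q m := by
    have := congrArg (eval Q) (X_mul_pderiv_monomial (R := A) (i := ⟨u, j⟩) (m := m.1) (r := 1))
    simpa [dmonVec, monVec] using this
  have hu : a u = ∑ j, m.1 ⟨u, j⟩ := by rw [← weight_mpWeight_apply, m.2]
  simp only [h]
  rw [← Finset.sum_mul, hu, Nat.cast_sum]

theorem monVec_stdIdx_single_mul (ha : ∀ i, 0 < a i) (g : ∀ i, Fin (n i + 1)) (Q : MPIdx k n → A)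
    (y : MPIdx k n) :
    monVec a Q (stdIdx a g (Finsupp.single y 1) (weight_single_le ha y)) * Q ⟨y.1, g y.1⟩ =
      monVec a Q (stdIdx a g 0 (by simp)) * Q y := by
  have h : (stdIdx a g (Finsupp.single y 1) (weight_single_le ha y)).1 +
      Finsupp.single ⟨y.1, g y.1⟩ 1 = (stdIdx a g 0 (by simp)).1 + Finsupp.single y 1 := by
    have h1 : (Finsupp.single ⟨y.1, g y.1⟩ 1 : MPIdx k n →₀ ℕ) =
        ∑ u, Finsupp.single ⟨u, g u⟩ (Finsupp.weight (mpWeight k n) (Finsupp.single y 1) u) := by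
      rw [Finset.sum_eq_single y.1]
      · simp [Finsupp.weight_single, mpWeight]
      · intro u _ hu
        simp [Finsupp.weight_single, mpWeight, hu]
      · simp
    rw [h1]
    simp only [stdIdx]
    rw [add_right_comm, ← Finset.sum_add_distrib, map_zero, add_zero]
    congr 1
    refine Finset.sum_congr rfl fun u _ => ?_
    rw [← Finsupp.single_add, Nat.sub_add_cancel (weight_single_le ha y u)]
    rfl
  have h2 := congrArg (fun m => eval Q (monomial m 1)) h
  simpa [monVec, monomial_add_single] using h2

theorem monVec_stdIdx_zero_ne_zero [IsDomain A] (g : ∀ i, Fin (n i + 1)) {Q : MPIdx k n → A}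
    (hQ : ∀ u, Q ⟨u, g u⟩ ≠ 0) : monVec a Q (stdIdx a g 0 (by simp)) ≠ 0 := by
  rw [monVec, eval_monomial, one_mul]
  refine Finset.prod_ne_zero_iff.2 fun x hx => pow_ne_zero _ ?_
  by_cases h : x.2 = g x.1
  · have := hQ x.1
    rwa [← h] at this
  · rw [Finsupp.mem_support_iff, stdIdx_off _ _ _ h] at hx
    exact (hx rfl).elim

theorem derivation_monVec (δ : Derivation ℤ A A) (Q : MPIdx k n → A) (m : MonIdx n a) :
    δ (monVec a Q m) = ∑ y, dmonVec a Q y m * δ (Q y) := by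
  have key (f : MvPolynomial (MPIdx k n) ℤ) :
      δ (aeval Q f) = ∑ y, aeval Q (pderiv y f) * δ (Q y) := by
    classical
    induction f using MvPolynomial.induction_on with
    | C r => simp
    | add p q hp hq => simp [hp, hq, add_mul, Finset.sum_add_distrib]
    | mul_X p x hp =>
      simp only [map_mul, aeval_X, Derivation.leibniz, smul_eq_mul, hp, pderiv_X, map_add,
        add_mul, Finset.sum_add_distrib, Finset.mul_sum]
      congr 1
      · rw [Finset.sum_eq_single x]
        · simp
        · intro y _ hy
          simp [hy.symm]
        · simp
      · exact Finset.sum_congr rfl fun y _ => by ring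
  have := key (monomial m.1 1)
  simpa [aeval_monomial, pderiv_monomial, monVec, dmonVec, eval_monomial] using this

/-- The polynomial of multidegree `a` with a given vector of coefficients. -/
noncomputable def vecPoly (c : MonIdx n a → A) : MvPolynomial (MPIdx k n) A :=
  ∑ m, C (c m) * monomial m.1 1

theorem isWeightedHomogeneous_vecPoly (c : MonIdx n a → A) :
    IsWeightedHomogeneous (mpWeight k n) (vecPoly c) a := by
  refine IsWeightedHomogeneous.sum _ _ _ fun m _ => ?_
  rw [C_mul_monomial]
  exact isWeightedHomogeneous_monomial _ _ _ m.2

theorem eval_vecPoly (c : MonIdx n a → A) (Q : MPIdx k n → A) :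
    eval Q (vecPoly c) = ∑ m, c m * monVec a Q m := by
  simp [vecPoly, monVec, eval_monomial]

theorem aeval_pderiv_vecPoly (c : MonIdx n a → A) (Q : MPIdx k n → B) (y : MPIdx k n) :
    aeval Q (pderiv y (vecPoly c)) = ∑ m, algebraMap A B (c m) * dmonVec a Q y m := by
  simp [vecPoly, dmonVec, aeval_monomial, eval_monomial, pderiv_monomial, Derivation.leibniz]

/-- The linear form vanishing at `P` in the factor of `y`, relative to the chart `g`. -/
noncomputable def ell (g : ∀ i, Fin (n i + 1)) (P : MPIdx k n → A) (y : MPIdx k n) :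
    MvPolynomial (MPIdx k n) A :=
  C (P ⟨y.1, g y.1⟩) * X y - C (P y) * X ⟨y.1, g y.1⟩

theorem aeval_ell (g : ∀ i, Fin (n i + 1)) (P : MPIdx k n → A) (y : MPIdx k n)
    (Q : MPIdx k n → B) : aeval Q (ell g P y) =
      algebraMap A B (P ⟨y.1, g y.1⟩) * Q y - algebraMap A B (P y) * Q ⟨y.1, g y.1⟩ := by
  simp [ell]

/-- The ideal generated by the forms of multidegree `a` vanishing at the points `T`. -/
noncomputable def formIdeal (a : Fin k → ℕ) {ι : Type} (T : ι → MPIdx k n → A) :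
    Ideal (MvPolynomial (MPIdx k n) A) :=
  Ideal.span {w | IsWeightedHomogeneous (mpWeight k n) w a ∧ ∀ l, eval (T l) w = 0}

theorem C_prod_mul_mem_span_ell (g : ∀ i, Fin (n i + 1)) (P : MPIdx k n → A)
    {w : MvPolynomial (MPIdx k n) A} (hw : IsWeightedHomogeneous (mpWeight k n) w a)
    (hP : eval P w = 0) : C (∏ u, P ⟨u, g u⟩ ^ a u) * w ∈
      Ideal.span (Set.range fun y : OffChart g => ell g P y.1) := by
  set I := Ideal.span (Set.range fun y : OffChart g => ell g P y.1)
  have h1 := aeval_scale (fun u => C (P ⟨u, g u⟩)) X hw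
  have h2 := aeval_scale (fun u => (X ⟨u, g u⟩ : MvPolynomial (MPIdx k n) A)) (fun x => C (P x)) hw
  have h3 : aeval (fun x => (C (P x) : MvPolynomial (MPIdx k n) A)) w = C (eval P w) := by
    rw [← coe_aeval_eq_eval, RingHom.coe_coe, ← algebraMap_eq, ← Algebra.ofId_apply,
      ← AlgHom.comp_apply, comp_aeval]
    rfl
  rw [h3, hP, map_zero, mul_zero] at h2
  simp only [aeval_X_left_apply, ← map_pow, ← map_prod] at h1
  rw [← h1, ← sub_zero (aeval _ w), ← h2, ← Ideal.Quotient.eq]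
  change Ideal.Quotient.mkₐ A I _ = Ideal.Quotient.mkₐ A I _
  rw [← AlgHom.comp_apply, ← AlgHom.comp_apply, comp_aeval, comp_aeval]
  congr 2
  ext x : 1
  refine Ideal.Quotient.eq.2 ?_
  by_cases hx : x.2 = g x.1
  · obtain ⟨u, j⟩ := x
    obtain rfl : j = g u := hx
    convert I.zero_mem using 1
    ring
  · rw [mul_comm (X _)]
    exact Ideal.subset_span ⟨⟨x, hx⟩, rfl⟩

end Homogeneous

section Generic

variable {k : ℕ} {n : Fin k → ℕ} {a : Fin k → ℕ} {F : Type} [Field F] {s : ℕ}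

/-- The ring of polynomials in the coordinates of `s` points. -/
abbrev CoordRing (F : Type) [Field F] (s : ℕ) {k : ℕ} (n : Fin k → ℕ) :=
  MvPolynomial (Fin s × MPIdx k n) F

/-- The generic points. -/
noncomputable def genPt (F : Type) [Field F] (s : ℕ) {k : ℕ} (n : Fin k → ℕ) (l : Fin s) :
    MPIdx k n → CoordRing F s n :=
  fun x => X (l, x)

theorem aeval_comp_genPt (T : Fin s → MPIdx k n → F) (l : Fin s) :
    (aeval (fun q : Fin s × MPIdx k n => T q.1 q.2) : CoordRing F s n →ₐ[F] F) ∘ genPt F s n l =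
      T l := by
  ext x
  simp [genPt]

variable [Infinite F]

theorem exists_generic_dual (ha : ∀ i, 0 < a i)
    (hs : s + ∑ i, n i < ∏ i, Nat.choose (n i + a i) (n i)) (g : ∀ i, Fin (n i + 1)) (i : Fin s) :
    ∃ Δ : CoordRing F s n, Δ ≠ 0 ∧ ∃ c : MonIdx n a → OffChart g ⊕ Fin s → CoordRing F s n,
      ∀ j j', ∑ m, Sum.elim (fun y : OffChart g => dmonVec a (genPt F s n i) y.1)
        (fun l => monVec a (genPt F s n l)) j m * c m j' = if j = j' then Δ else 0 := by
  obtain ⟨T, hT⟩ := exists_linearIndependent_tangent (F := F) ha hs g i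
  refine exists_dual_family_of_specialization
    (aeval (fun q : Fin s × MPIdx k n => T q.1 q.2) : CoordRing F s n →ₐ[F] F) ?_
  convert hT using 1
  ext (y | l) m
  · simp only [Sum.elim_inl]
    rw [← RingHom.coe_coe, dmonVec_map, RingHom.coe_coe, aeval_comp_genPt]
  · simp only [Sum.elim_inr]
    rw [← RingHom.coe_coe, monVec_map, RingHom.coe_coe, aeval_comp_genPt]

theorem exists_linearIndependent_generic_two_tangents (hk : 2 ≤ k) (hn : ∀ i, 1 ≤ n i)
    (ha : ∀ i, 0 < a i) (hs : s + ∑ i, n i < ∏ i, Nat.choose (n i + a i) (n i))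
    (g : ∀ i, Fin (n i + 1)) {i i' : Fin s} (hii : i ≠ i')
    (κ : Type) [Field κ] [Algebra (CoordRing F s n) κ] [FaithfulSMul (CoordRing F s n) κ] :
    ∃ x : MPIdx k n, LinearIndependent κ
      (Sum.elim (fun o : Option (OffChart g) =>
        o.elim (dmonVec a (algebraMap (CoordRing F s n) κ ∘ genPt F s n i') x)
          fun y => dmonVec a (algebraMap (CoordRing F s n) κ ∘ genPt F s n i) y.1)
        fun l => monVec a (algebraMap (CoordRing F s n) κ ∘ genPt F s n l)) := by
  obtain ⟨x, T, hT⟩ := exists_linearIndependent_two_tangents (F := F) hk hn ha hs g hii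
  refine ⟨x, ?_⟩
  obtain ⟨Δ, hΔ, c, hc⟩ := exists_dual_family_of_specialization
    (V := Sum.elim (fun o : Option (OffChart g) => o.elim (dmonVec a (genPt F s n i') x)
        fun y => dmonVec a (genPt F s n i) y.1) fun l => monVec a (genPt F s n l))
    (aeval (fun q : Fin s × MPIdx k n => T q.1 q.2) : CoordRing F s n →ₐ[F] F) (by
      convert hT using 1
      ext ((_ | y) | l) m
      · simp only [Sum.elim_inl, Option.elim]
        rw [← RingHom.coe_coe, dmonVec_map, RingHom.coe_coe, aeval_comp_genPt]
      · simp only [Sum.elim_inl, Option.elim]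
        rw [← RingHom.coe_coe, dmonVec_map, RingHom.coe_coe, aeval_comp_genPt]
      · simp only [Sum.elim_inr]
        rw [← RingHom.coe_coe, monVec_map, RingHom.coe_coe, aeval_comp_genPt])
  have hinj := FaithfulSMul.algebraMap_injective (CoordRing F s n) κ
  refine linearIndependent_of_dual_family (Δ := algebraMap _ κ Δ)
    (C := fun m j => algebraMap _ κ (c m j)) ((map_ne_zero_iff _ hinj).2 hΔ) fun j j' => ?_
  have h := congrArg (algebraMap _ κ) (hc j j')
  rw [map_sum] at h
  simp only [map_mul] at h
  rw [apply_ite (algebraMap _ κ), map_zero] at h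
  rw [← h]
  refine Finset.sum_congr rfl fun m _ => ?_
  congr 1
  rcases j with (_ | y) | l
  · exact (dmonVec_map _ _ _ _).symm
  · exact (dmonVec_map _ _ _ _).symm
  · exact (monVec_map _ _ _).symm

/-- A form which, up to the ideal of forms through the generic points, annihilates the ideal of
one of them and does not vanish there. -/
theorem exists_detector (ha : ∀ i, 0 < a i)
    (hs : s + ∑ i, n i < ∏ i, Nat.choose (n i + a i) (n i)) (g : ∀ i, Fin (n i + 1)) (l : Fin s) :
    ∃ h : MvPolynomial (MPIdx k n) (CoordRing F s n),
      (∀ y : OffChart g, h * ell g (genPt F s n l) y.1 ∈ formIdeal a (genPt F s n)) ∧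
      ∀ (κ : Type) [Field κ] [Algebra (CoordRing F s n) κ] [FaithfulSMul (CoordRing F s n) κ]
        (Q : MPIdx k n → κ), (∀ u, Q ⟨u, g u⟩ ≠ 0) →
        (∀ y : OffChart g, aeval Q (ell g (genPt F s n l) y.1) = 0) → aeval Q h ≠ 0 := by
  obtain ⟨Δ, hΔ, c, hc⟩ := exists_generic_dual (F := F) ha hs g l
  let w (z : OffChart g) := vecPoly fun m => c m (Sum.inl z)
  have hw0 (z : OffChart g) (l' : Fin s) : eval (genPt F s n l') (w z) = 0 := by
    have h2 := hc (Sum.inr l') (Sum.inl z)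
    simp only [Sum.elim_inr, reduceCtorEq, if_false] at h2
    rw [eval_vecPoly, ← h2]
    exact Finset.sum_congr rfl fun m _ => mul_comm _ _
  have hwhom (z : OffChart g) := isWeightedHomogeneous_vecPoly fun m => c m (Sum.inl z)
  have hmem (z : OffChart g) := C_prod_mul_mem_span_ell g (genPt F s n l) (hwhom z) (hw0 z l)
  set π := ∏ u, genPt F s n l ⟨u, g u⟩ ^ a u with hπ
  choose M hM using fun z => Ideal.mem_span_range_iff_exists_fun.1 (hmem z)
  refine ⟨(Matrix.of M).det, fun y => ?_, fun κ _ _ _ Q hQ hell => ?_⟩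
  · have h1 : (Matrix.of M).det * ell g (genPt F s n l) y.1 =
        ∑ z, (Matrix.of M).adjugate y z * (C π * w z) := by
      have h2 := congrFun (congrArg (fun N => Matrix.mulVec N fun y : OffChart g =>
        ell g (genPt F s n l) y.1) (Matrix.adjugate_mul (Matrix.of M))) y
      simp only [← Matrix.mulVec_mulVec, Matrix.smul_mulVec, Matrix.one_mulVec, Pi.smul_apply,
        smul_eq_mul] at h2
      rw [← h2, Matrix.mulVec, dotProduct]
      refine Finset.sum_congr rfl fun z _ => ?_
      rw [← hM z]
      rfl
    rw [h1]
    exact Ideal.sum_mem _ fun z _ => Ideal.mul_mem_left _ _ (Ideal.mul_mem_left _ _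
      (Ideal.subset_span ⟨hwhom z, hw0 z⟩))
  · have hinj := FaithfulSMul.algebraMap_injective (CoordRing F s n) κ
    let p : MPIdx k n → κ := algebraMap (CoordRing F s n) κ ∘ genPt F s n l
    have hp (x : MPIdx k n) : p x ≠ 0 := (map_ne_zero_iff _ hinj).2 (X_ne_zero _)
    let lam (u : Fin k) : κ := Q ⟨u, g u⟩ / p ⟨u, g u⟩
    have hlam (u : Fin k) : lam u ≠ 0 := div_ne_zero (hQ u) (hp _)
    have hQp : Q = fun x => lam x.1 * p x := by
      ext x
      by_cases hx : x.2 = g x.1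
      · obtain ⟨u, j⟩ := x
        obtain rfl : j = g u := hx
        exact (div_mul_cancel₀ _ (hp _)).symm
      · have h1 := hell ⟨x, hx⟩
        rw [aeval_ell, sub_eq_zero] at h1
        change p ⟨x.1, g x.1⟩ * Q x = p x * Q ⟨x.1, g x.1⟩ at h1
        have h2 := hp ⟨x.1, g x.1⟩
        simp only [lam]
        field_simp
        linear_combination h1
    have hdw (z y : OffChart g) : lam y.1.1 * aeval Q (pderiv y.1 (w z)) =
        (∏ u, lam u ^ a u) * if z = y then algebraMap _ κ Δ else 0 := by
      rw [aeval_pderiv_vecPoly, hQp, Finset.mul_sum]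
      have h1 := congrArg (algebraMap _ κ) (hc (Sum.inl y) (Sum.inl z))
      rw [map_sum, apply_ite (algebraMap _ κ), map_zero] at h1
      simp only [Sum.inl.injEq, eq_comm (a := y)] at h1
      rw [← h1, Finset.mul_sum]
      refine Finset.sum_congr rfl fun m _ => ?_
      rw [mul_left_comm, dmonVec_scale, map_mul, Sum.elim_inl, dmonVec_map]
      ring
    have hent (z y : OffChart g) : aeval Q (M z y) * p ⟨y.1.1, g y.1.1⟩ =
        algebraMap _ κ π * aeval Q (pderiv y.1 (w z)) := by
      have h1 := congrArg (fun f => aeval Q (pderiv y.1 f)) (hM z)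
      simp only [map_sum, Derivation.leibniz, smul_eq_mul, map_add, map_mul, hell, zero_mul,
        add_zero, pderiv_C, mul_zero, aeval_C] at h1
      rw [← h1, Finset.sum_eq_single y]
      · have : (⟨y.1.1, g y.1.1⟩ : MPIdx k n) ≠ y.1 := fun h => y.2 (by
          rw [← h])
        simp [ell, Derivation.leibniz, pderiv_X_of_ne this, p]
      · intro y' _ hy'
        have h2 : y'.1 ≠ y.1 := fun h => hy' (Subtype.ext h)
        have h3 : (⟨y'.1.1, g y'.1.1⟩ : MPIdx k n) ≠ y.1 := fun h => y.2 (by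
          rw [← h])
        simp [ell, Derivation.leibniz, pderiv_X_of_ne h2, pderiv_X_of_ne h3]
      · simp
    rw [AlgHom.map_det]
    have hdiag : (aeval Q).mapMatrix (Matrix.of M) =
        Matrix.diagonal fun y => aeval Q (M y y) := by
      ext z y
      rw [Matrix.diagonal_apply]
      split_ifs with hzy
      · rw [hzy]
        rfl
      · change aeval Q (M z y) = 0
        have h1 := hdw z y
        rw [if_neg hzy, mul_zero, mul_eq_zero, or_iff_right (hlam _)] at h1
        have h2 := hent z y
        rw [h1, mul_zero, mul_eq_zero, or_iff_left (hp _)] at h2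
        exact h2
    rw [hdiag, Matrix.det_diagonal]
    refine Finset.prod_ne_zero_iff.2 fun y _ h0 => ?_
    have h1 := hdw y y
    rw [if_pos rfl] at h1
    have h2 := hent y y
    rw [h0, zero_mul, eq_comm, mul_eq_zero] at h2
    rcases h2 with h2 | h2
    · rw [hπ, map_prod, Finset.prod_eq_zero_iff] at h2
      obtain ⟨u, -, hu⟩ := h2
      rw [map_pow] at hu
      exact hp _ (pow_eq_zero_iff (ha u).ne' |>.1 hu)
    · rw [h2, mul_zero] at h1
      exact mul_ne_zero (Finset.prod_ne_zero_iff.2 fun u _ => pow_ne_zero _ (hlam u))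
        ((map_ne_zero_iff _ hinj).2 hΔ) h1.symm

end Generic

section BasePoint

variable {k : ℕ} {n : Fin k → ℕ} {a : Fin k → ℕ} {F : Type} [Field F] {s : ℕ}

/-- A point satisfying all forms through the generic points has a monomial vector which is a
combination of those of the generic points. -/
theorem exists_monVec_eq_sum [Infinite F] (ha : ∀ i, 0 < a i) (hs0 : 0 < s)
    (hs : s + ∑ i, n i < ∏ i, Nat.choose (n i + a i) (n i)) {κ : Type} [Field κ]
    [Algebra (CoordRing F s n) κ] [FaithfulSMul (CoordRing F s n) κ] {Q : MPIdx k n → κ}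
    (hQ : ∀ f ∈ formIdeal a (genPt F s n), aeval Q f = 0) :
    ∃ c : Fin s → κ, ∀ m, monVec a Q m =
      ∑ l, c l * monVec a (algebraMap (CoordRing F s n) κ ∘ genPt F s n l) m := by
  obtain ⟨Δ, hΔ, c, hc⟩ := exists_generic_dual (F := F) ha hs 0 ⟨0, hs0⟩
  have hΔ' : algebraMap _ κ Δ ≠ 0 :=
    (map_ne_zero_iff _ (FaithfulSMul.algebraMap_injective (CoordRing F s n) κ)).2 hΔ
  let e (i : Fin s) := vecPoly fun m => c m (Sum.inr i)
  have he (i l : Fin s) : eval (genPt F s n l) (e i) = if l = i then Δ else 0 := by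
    have h1 := hc (Sum.inr l) (Sum.inr i)
    simp only [Sum.elim_inr, Sum.inr.injEq] at h1
    rw [eval_vecPoly, ← h1]
    exact Finset.sum_congr rfl fun m _ => mul_comm _ _
  refine ⟨fun i => aeval Q (e i) / algebraMap _ κ Δ, fun m => ?_⟩
  have hmem : C Δ * monomial m.1 1 - ∑ i, C (monVec a (genPt F s n i) m) * e i ∈
      formIdeal a (genPt F s n) := by
    refine Ideal.subset_span ⟨?_, fun l => ?_⟩
    · have h1 : C Δ * monomial m.1 1 ∈ weightedHomogeneousSubmodule (CoordRing F s n)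
          (mpWeight k n) a := by
        rw [C_mul_monomial]
        exact isWeightedHomogeneous_monomial _ _ _ m.2
      refine Submodule.sub_mem _ h1 (Submodule.sum_mem _ fun i _ => ?_)
      rw [C_mul']
      exact Submodule.smul_mem _ _ (isWeightedHomogeneous_vecPoly _)
    · rw [map_sub, map_sum]
      simp only [map_mul, eval_C, he, mul_ite, mul_zero, Finset.sum_ite_eq, Finset.mem_univ,
        if_true]
      rw [mul_comm, ← monVec, sub_self]
  have h1 := hQ _ hmem
  rw [map_sub, map_sum, sub_eq_zero] at h1
  simp only [map_mul, aeval_C] at h1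
  have h2 : aeval Q (monomial m.1 (1 : CoordRing F s n)) = monVec a Q m := by
    simp [aeval_monomial, monVec, eval_monomial]
  rw [h2, mul_comm, ← eq_div_iff hΔ'] at h1
  rw [h1, Finset.sum_div]
  refine Finset.sum_congr rfl fun i _ => ?_
  rw [monVec_map]
  ring

theorem aeval_ell_eq_zero_of_monVec {A κ : Type} [CommRing A] [Field κ] [Algebra A κ]
    (ha : ∀ i, 0 < a i) (g : ∀ i, Fin (n i + 1)) {P : MPIdx k n → A} {Q : MPIdx k n → κ}
    (hQ : ∀ u, Q ⟨u, g u⟩ ≠ 0) {c : κ}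
    (h : ∀ m, monVec a Q m = c * monVec a (algebraMap A κ ∘ P) m) (y : MPIdx k n) :
    aeval Q (ell g P y) = 0 := by
  have h0 := monVec_stdIdx_zero_ne_zero (a := a) g hQ
  have h1 := monVec_stdIdx_single_mul ha g Q y
  have h2 := monVec_stdIdx_single_mul ha g (algebraMap A κ ∘ P) y
  refine mul_left_cancel₀ h0 ?_
  rw [aeval_ell]
  simp only [Function.comp_apply] at h2
  rw [h, h] at h1
  rw [h]
  linear_combination (-algebraMap A κ (P ⟨y.1, g y.1⟩)) * h1 + c * Q ⟨y.1, g y.1⟩ * h2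

/-- If the monomial vector of `Q` is a combination of those of the generic points, the tangent
vectors at the points with nonzero coefficient are in the span of those vectors and of the tangent
vectors at `Q`. -/
theorem dmonVec_mem_span [CharZero F] {κ : Type} [Field κ]
    [Algebra (CoordRing F s n) κ] [FaithfulSMul (CoordRing F s n) κ]
    [Algebra.EssFiniteType (CoordRing F s n) κ] {Q : MPIdx k n → κ} {c : Fin s → κ}
    (hc : ∀ m, monVec a Q m =
      ∑ l, c l * monVec a (algebraMap (CoordRing F s n) κ ∘ genPt F s n l) m)
    {i : Fin s} (hi : c i ≠ 0) (x : MPIdx k n) {U : Submodule κ (MonIdx n a → κ)}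
    (hU : ∀ l, monVec a (algebraMap (CoordRing F s n) κ ∘ genPt F s n l) ∈ U)
    (hU' : ∀ y, dmonVec a Q y ∈ U) :
    dmonVec a (algebraMap (CoordRing F s n) κ ∘ genPt F s n i) x ∈ U := by
  classical
  obtain ⟨δ, hδ⟩ := exists_derivation_extension (κ := κ)
    ((pderiv (R := F) (i, x)).restrictScalars ℤ)
  have hgen (l : Fin s) (y : MPIdx k n) :
      δ (algebraMap (CoordRing F s n) κ (genPt F s n l y)) = if (l, y) = (i, x) then 1 else 0 := by
    rw [hδ]
    change algebraMap _ κ (pderiv (i, x) (X (l, y))) = _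
    rw [pderiv_X, Pi.single_apply]
    split_ifs <;> simp_all
  have hd (l : Fin s) (m : MonIdx n a) :
      δ (monVec a (algebraMap (CoordRing F s n) κ ∘ genPt F s n l) m) =
        if l = i then dmonVec a (algebraMap (CoordRing F s n) κ ∘ genPt F s n i) x m else 0 := by
    rw [derivation_monVec]
    simp only [Function.comp_apply, hgen, Prod.mk.injEq, mul_ite, mul_one, mul_zero]
    split_ifs with hl
    · simp [hl]
    · simp [hl]
  have key : c i • dmonVec a (algebraMap (CoordRing F s n) κ ∘ genPt F s n i) x =
      ∑ y, δ (Q y) • dmonVec a Q y -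
        ∑ l, δ (c l) • monVec a (algebraMap (CoordRing F s n) κ ∘ genPt F s n l) := by
    ext m
    have h1 := congrArg δ (hc m)
    rw [derivation_monVec, map_sum] at h1
    simp only [Derivation.leibniz, hd, smul_eq_mul, mul_ite, mul_zero, Finset.sum_add_distrib,
      Finset.sum_ite_eq', Finset.mem_univ, if_true] at h1
    simp only [Pi.sub_apply, Finset.sum_apply, Pi.smul_apply, smul_eq_mul]
    rw [eq_sub_iff_add_eq]
    simp only [mul_comm (δ _)] at h1 ⊢
    rw [h1]
  rw [← U.smul_mem_iff hi, key]
  exact U.sub_mem (U.sum_mem fun y _ => U.smul_mem _ (hU' y))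
    (U.sum_mem fun l _ => U.smul_mem _ (hU l))

/-- In the chart `g`, a base point of the forms through the generic points is one of those. -/
theorem exists_aeval_ell_eq_zero [CharZero F] (hk : 2 ≤ k) (hn : ∀ i, 1 ≤ n i)
    (ha : ∀ i, 0 < a i) (hs0 : 0 < s) (hs : s + ∑ i, n i < ∏ i, Nat.choose (n i + a i) (n i))
    (g : ∀ i, Fin (n i + 1)) {κ : Type} [Field κ] [Algebra (CoordRing F s n) κ]
    [FaithfulSMul (CoordRing F s n) κ] [Algebra.EssFiniteType (CoordRing F s n) κ]
    {Q : MPIdx k n → κ} (hQg : ∀ u, Q ⟨u, g u⟩ ≠ 0)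
    (hQ : ∀ f ∈ formIdeal a (genPt F s n), aeval Q f = 0) :
    ∃ l, ∀ y, aeval Q (ell g (genPt F s n l) y) = 0 := by
  classical
  obtain ⟨c, hc⟩ := exists_monVec_eq_sum ha hs0 hs hQ
  by_cases h : ∃ i i', i ≠ i' ∧ c i ≠ 0 ∧ c i' ≠ 0
  · exfalso
    obtain ⟨i, i', hii, hi, hi'⟩ := h
    let V : OffChart g ⊕ Fin s → MonIdx n a → κ := Sum.elim (fun y => dmonVec a Q y.1)
      fun l => monVec a (algebraMap (CoordRing F s n) κ ∘ genPt F s n l)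
    let U := Submodule.span κ (Set.range V)
    have hU (l : Fin s) : monVec a (algebraMap (CoordRing F s n) κ ∘ genPt F s n l) ∈ U :=
      Submodule.subset_span ⟨Sum.inr l, rfl⟩
    have hUoff (y : OffChart g) : dmonVec a Q y.1 ∈ U :=
      Submodule.subset_span ⟨Sum.inl y, rfl⟩
    have hQU : monVec a Q ∈ U := by
      have : monVec a Q =
          ∑ l, c l • monVec a (algebraMap (CoordRing F s n) κ ∘ genPt F s n l) := by
        ext m
        simp [hc m]
      rw [this]
      exact U.sum_mem fun l _ => U.smul_mem _ (hU l)
    have hU' (y : MPIdx k n) : dmonVec a Q y ∈ U := by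
      by_cases hy : y.2 = g y.1
      · obtain ⟨u, j⟩ := y
        obtain rfl : j = g u := hy
        rw [← U.smul_mem_iff (hQg u)]
        have : Q ⟨u, g u⟩ • dmonVec a Q ⟨u, g u⟩ = (a u : κ) • monVec a Q -
            ∑ j ∈ Finset.univ.erase (g u), Q ⟨u, j⟩ • dmonVec a Q ⟨u, j⟩ := by
          ext m
          have h1 := sum_mul_dmonVec Q u m
          rw [← Finset.add_sum_erase _ _ (Finset.mem_univ (g u))] at h1
          simp only [Pi.sub_apply, Finset.sum_apply, Pi.smul_apply, smul_eq_mul]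
          rw [← h1]
          ring
        rw [this]
        exact U.sub_mem (U.smul_mem _ hQU) (U.sum_mem fun j hj => U.smul_mem _
          (hUoff ⟨⟨u, j⟩, Finset.ne_of_mem_erase hj⟩))
      · exact hUoff ⟨y, hy⟩
    obtain ⟨x, hx⟩ := exists_linearIndependent_generic_two_tangents (F := F) hk hn ha hs g hii κ
    have h1 := finrank_span_eq_card hx
    have h2 : Set.finrank κ (Set.range V) ≤ _ := finrank_range_le_card V
    have h3 := h1.symm.trans_le (Submodule.finrank_mono (t := U) (Submodule.span_le.2 (by
      rintro _ ⟨(_ | y) | l, rfl⟩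
      · exact dmonVec_mem_span hc hi' x hU hU'
      · exact dmonVec_mem_span hc hi y.1 hU hU'
      · exact hU l)))
    have h4 := h3.trans h2
    simp only [Fintype.card_sum, Fintype.card_option] at h4
    omega
  · push Not at h
    obtain ⟨i, hi⟩ : ∃ i, ∀ i', i' ≠ i → c i' = 0 := by
      by_cases h0 : ∃ i, c i ≠ 0
      · obtain ⟨i, hi⟩ := h0
        exact ⟨i, fun i' hi' => h i i' hi'.symm hi⟩
      · push Not at h0
        exact ⟨⟨0, hs0⟩, fun i' _ => h0 i'⟩
    refine ⟨i, aeval_ell_eq_zero_of_monVec ha g hQg (c := c i) fun m => ?_⟩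
    rw [hc, Finset.sum_eq_single i]
    · intro l _ hl
      rw [hi l hl, zero_mul]
    · simp

end BasePoint

section Certificate

variable {k : ℕ} {n : Fin k → ℕ} {a : Fin k → ℕ} {F : Type} [Field F] {s : ℕ}

/-- The product of the variables of the chart `g`. -/
noncomputable def chartMon (A : Type) [CommRing A] (g : ∀ i, Fin (n i + 1)) :
    MvPolynomial (MPIdx k n) A :=
  ∏ u, X ⟨u, g u⟩

/-- In the chart `g`, products of one linear form for each generic point belong to the ideal
of forms through the generic points, up to denominators. -/
theorem exists_certificate [CharZero F] (hk : 2 ≤ k) (hn : ∀ i, 1 ≤ n i)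
    (ha : ∀ i, 0 < a i) (hs0 : 0 < s) (hs : s + ∑ i, n i < ∏ i, Nat.choose (n i + a i) (n i))
    (g : ∀ i, Fin (n i + 1)) (y : Fin s → OffChart g) :
    ∃ D : CoordRing F s n, D ≠ 0 ∧ ∃ N : ℕ,
      C D * chartMon (CoordRing F s n) g ^ N * ∏ l, ell g (genPt F s n l) (y l).1 ∈
        formIdeal a (genPt F s n) := by
  classical
  by_contra! hcon
  let B := MvPolynomial (MPIdx k n) (CoordRing F s n)
  let S : Submonoid B :=
    { carrier := {f | ∃ D : CoordRing F s n, D ≠ 0 ∧ ∃ N : ℕ, f = C D * chartMon _ g ^ N}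
      one_mem' := ⟨1, one_ne_zero, 0, by simp⟩
      mul_mem' := by
        rintro _ _ ⟨D, hD, N, rfl⟩ ⟨D', hD', N', rfl⟩
        refine ⟨D * D', mul_ne_zero hD hD', N + N', ?_⟩
        rw [map_mul, pow_add]
        ring }
  let Λ : B := ∏ l, ell g (genPt F s n l) (y l).1
  obtain ⟨p, hp, hle, hdisj⟩ := Ideal.exists_le_prime_disjoint
    ((formIdeal a (genPt F s n)).colon {Λ}) S (by
      rw [Set.disjoint_left]
      rintro _ hf ⟨D, hD, N, rfl⟩
      exact hcon D hD N (Submodule.mem_colon_singleton.1 hf))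
  have hJp {f : B} (hf : f ∈ formIdeal a (genPt F s n)) : f ∈ p :=
    hle (Submodule.mem_colon_singleton.2 (Ideal.mul_mem_right _ _ hf))
  let κ := FractionRing (B ⧸ p)
  let Q : MPIdx k n → κ := fun x => algebraMap (B ⧸ p) κ (Ideal.Quotient.mk p (X x))
  have hQ (f : B) : aeval Q f = algebraMap (B ⧸ p) κ (Ideal.Quotient.mk p f) := by
    have h1 : (aeval Q : B →ₐ[CoordRing F s n] κ) =
        ((Algebra.algHom (CoordRing F s n) (B ⧸ p) κ).comp
          (Ideal.Quotient.mkₐ (CoordRing F s n) p)) := by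
      ext x
      rw [aeval_X]
      rfl
    exact DFunLike.congr_fun h1 f
  have hinj := IsFractionRing.injective (B ⧸ p) κ
  have hQ0 (f : B) : aeval Q f = 0 ↔ f ∈ p := by
    rw [hQ, map_eq_zero_iff _ hinj, Ideal.Quotient.eq_zero_iff_mem]
  have hS {f : B} (hf : f ∈ S) : f ∉ p := fun h => Set.disjoint_left.1 hdisj h hf
  have : FaithfulSMul (CoordRing F s n) κ := by
    rw [faithfulSMul_iff_algebraMap_injective, injective_iff_map_eq_zero]
    intro D hD
    by_contra hD0
    refine hS (f := C D) ⟨D, hD0, 0, by simp⟩ ((hQ0 _).1 ?_)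
    rwa [aeval_C]
  have : Algebra.EssFiniteType (CoordRing F s n) κ := .comp _ (B ⧸ p) _
  have hQg (u : Fin k) : Q ⟨u, g u⟩ ≠ 0 := by
    have h1 : chartMon (CoordRing F s n) g ∉ p := hS ⟨1, one_ne_zero, 1, by simp⟩
    rw [← hQ0, chartMon, map_prod, Finset.prod_eq_zero_iff] at h1
    intro h
    exact h1 ⟨u, Finset.mem_univ u, by rwa [aeval_X]⟩
  obtain ⟨l, hl⟩ := exists_aeval_ell_eq_zero (κ := κ) hk hn ha hs0 hs g hQg
    fun f hf => (hQ0 f).2 (hJp hf)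
  obtain ⟨h, hh, hh0⟩ := exists_detector (F := F) ha hs g l
  refine hh0 κ Q hQg (fun y => hl y.1) ((hQ0 _).2 (hle (Submodule.mem_colon_singleton.2 ?_)))
  change h * ∏ l, ell g (genPt F s n l) (y l).1 ∈ _
  rw [← Finset.mul_prod_erase _ _ (Finset.mem_univ l), ← mul_assoc]
  exact Ideal.mul_mem_right _ _ (hh (y l))

theorem map_mem_formIdeal {A A' ι : Type} [CommRing A] [CommRing A'] (φ : A →+* A')
    (T : ι → MPIdx k n → A) {f : MvPolynomial (MPIdx k n) A} (hf : f ∈ formIdeal a T) :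
    map φ f ∈ formIdeal a fun l => φ ∘ T l := by
  have h : formIdeal a T ≤ (formIdeal a fun l => φ ∘ T l).comap (map φ) := by
    refine Ideal.span_le.2 fun w hw => Ideal.subset_span ⟨fun m hm => ?_, fun l => ?_⟩
    · rw [coeff_map] at hm
      exact hw.1 (ne_zero_of_map hm)
    · rw [← map_eval, hw.2, map_zero]
  exact h hf

end Certificate

section Conclusion

variable {k : ℕ} {n : Fin k → ℕ} {a : Fin k → ℕ} {K : Type} [Field K]

theorem mem_span_ell (g : ∀ i, Fin (n i + 1)) {P : MPIdx k n → K} (hP : ∀ u, P ⟨u, g u⟩ ≠ 0)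
    [Infinite K] {f : MvPolynomial (MPIdx k n) K}
    (hf : ∀ lam : Fin k → K, eval (fun x => lam x.1 * P x) f = 0) :
    f ∈ Ideal.span (Set.range fun y : OffChart g => ell g P y.1) := by
  set I := Ideal.span (Set.range fun y : OffChart g => ell g P y.1)
  let z : MPIdx k n → MvPolynomial (MPIdx k n) K :=
    fun x => C (P x / P ⟨x.1, g x.1⟩) * X ⟨x.1, g x.1⟩
  have h1 : aeval z f = 0 := by
    refine MvPolynomial.funext fun Q => ?_
    rw [map_zero, ← hf fun u => Q ⟨u, g u⟩ / P ⟨u, g u⟩, aeval_def, eval₂_comp_left]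
    have : (eval Q).comp (algebraMap K (MvPolynomial (MPIdx k n) K)) = RingHom.id K := by
      ext
      simp
    rw [this, eval₂_id]
    congr 2
    ext x
    simp only [Function.comp_apply, z, map_mul, eval_C, eval_X]
    ring
  rw [← sub_zero f, ← h1, ← Ideal.Quotient.eq]
  conv_lhs => rw [← aeval_X_left_apply f]
  change Ideal.Quotient.mkₐ K I _ = Ideal.Quotient.mkₐ K I _
  rw [← AlgHom.comp_apply, ← AlgHom.comp_apply, comp_aeval, comp_aeval]
  congr 2
  ext x : 1
  refine Ideal.Quotient.eq.2 ?_
  have h2 : X x - z x = C (P ⟨x.1, g x.1⟩)⁻¹ * ell g P x := by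
    simp only [z, ell, mul_sub, ← mul_assoc, ← map_mul, inv_mul_cancel₀ (hP x.1), map_one, one_mul]
    rw [div_eq_inv_mul]
  rw [h2]
  refine Ideal.mul_mem_left _ _ ?_
  by_cases hx : x.2 = g x.1
  · obtain ⟨u, j⟩ := x
    obtain rfl : j = g u := hx
    convert I.zero_mem using 1
    rw [ell, sub_self]
  · exact Ideal.subset_span ⟨⟨x, hx⟩, rfl⟩

/-- Given the certificates in the chart `g` for distinct points, a polynomial vanishing on the
cones over the points is, up to a power of the monomial of `g`, in the ideal of forms. -/
theorem chartMon_mem_radical_colon [Infinite K] {s : ℕ} (g : ∀ i, Fin (n i + 1))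
    [Nonempty (OffChart g)] {T : Fin s → MPIdx k n → K} (hT : ∀ l x, T l x ≠ 0)
    (hdist : ∀ l l', l ≠ l' → ∃ y : OffChart g,
      T l ⟨y.1.1, g y.1.1⟩ * T l' y.1 - T l y.1 * T l' ⟨y.1.1, g y.1.1⟩ ≠ 0)
    (hcert : ∀ y : Fin s → OffChart g, ∃ N : ℕ,
      chartMon K g ^ N * ∏ l, ell g (T l) (y l).1 ∈ formIdeal a T)
    {f : MvPolynomial (MPIdx k n) K}
    (hf : ∀ l (lam : Fin k → K), eval (fun x => lam x.1 * T l x) f = 0) :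
    chartMon K g ∈ ((formIdeal a T).colon {f}).radical := by
  classical
  rw [Ideal.radical_eq_sInf, Submodule.mem_sInf]
  rintro p ⟨hle, hp⟩
  by_contra hg
  have hX (u : Fin k) : (X ⟨u, g u⟩ : MvPolynomial (MPIdx k n) K) ∉ p := fun h =>
    hg (Ideal.IsPrime.prod_mem_iff.2 ⟨u, Finset.mem_univ u, h⟩)
  by_cases h : ∀ l, ∃ y : OffChart g, ell g (T l) y.1 ∉ p
  · choose y hy using h
    obtain ⟨N, hN⟩ := hcert y
    have h1 := hle (Submodule.mem_colon_singleton.2 (Ideal.mul_mem_right f _ hN))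
    rcases hp.mem_or_mem h1 with h2 | h2
    · exact hg (hp.mem_of_pow_mem _ h2)
    · obtain ⟨l, -, hl⟩ := Ideal.IsPrime.prod_mem_iff.1 h2
      exact hy l hl
  · push Not at h
    obtain ⟨l, hl⟩ := h
    have hother (l' : Fin s) (hl' : l' ≠ l) : ∃ y : OffChart g, ell g (T l') y.1 ∉ p := by
      obtain ⟨y, hy⟩ := hdist l' l hl'
      refine ⟨y, fun h1 => hX y.1.1 ?_⟩
      have h2 := Ideal.sub_mem p (Ideal.mul_mem_left p (C (T l' ⟨y.1.1, g y.1.1⟩)) (hl y))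
        (Ideal.mul_mem_left p (C (T l ⟨y.1.1, g y.1.1⟩)) h1)
      have h3 : C (T l' ⟨y.1.1, g y.1.1⟩) * ell g (T l) y.1 -
          C (T l ⟨y.1.1, g y.1.1⟩) * ell g (T l') y.1 =
          C (-(T l' ⟨y.1.1, g y.1.1⟩ * T l y.1 - T l' y.1 * T l ⟨y.1.1, g y.1.1⟩)) *
            X ⟨y.1.1, g y.1.1⟩ := by
        simp only [ell, map_sub, map_mul, map_neg]
        ring
      rw [h3] at h2
      refine (hp.mem_or_mem h2).resolve_left fun h4 => hp.ne_top ?_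
      exact Ideal.eq_top_of_isUnit_mem _ h4 ((isUnit_iff_ne_zero.2 (neg_ne_zero.2 hy)).map C)
    have hy (l' : Fin s) : ∃ y : OffChart g, l' ≠ l → ell g (T l') y.1 ∉ p := by
      by_cases hl' : l' = l
      · exact ⟨Classical.arbitrary _, fun h => (h hl').elim⟩
      · exact (hother l' hl').imp fun y hy _ => hy
    choose y hy using hy
    choose N hN using fun z => hcert (Function.update y l z)
    let N₀ := Finset.univ.sup N
    have hmem : chartMon K g ^ N₀ * ∏ l' ∈ Finset.univ.erase l, ell g (T l') (y l').1 ∈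
        (formIdeal a T).colon {f} := by
      rw [Submodule.mem_colon_singleton]
      have h1 := mem_span_ell g (fun u => hT l _) (hf l)
      have h2 : Ideal.span (Set.range fun z : OffChart g => ell g (T l) z.1) ≤
          (formIdeal a T).colon
            {chartMon K g ^ N₀ * ∏ l' ∈ Finset.univ.erase l, ell g (T l') (y l').1} := by
        refine Ideal.span_le.2 ?_
        rintro _ ⟨z, rfl⟩
        refine Submodule.mem_colon_singleton.2 ?_
        have h3 := hN z
        rw [← Finset.mul_prod_erase _ _ (Finset.mem_univ l), Function.update_self,
          Finset.prod_congr rfl fun l' hl' => by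
            rw [Function.update_of_ne (Finset.ne_of_mem_erase hl')]] at h3
        have hle' : N z ≤ N₀ := Finset.le_sup (f := N) (Finset.mem_univ z)
        rw [← Nat.sub_add_cancel hle', pow_add]
        convert Ideal.mul_mem_left _ (chartMon K g ^ (N₀ - N z)) h3 using 1
        simp only [smul_eq_mul]
        ring
      have h3 := Submodule.mem_colon_singleton.1 (h2 h1)
      rw [smul_eq_mul] at h3 ⊢
      rwa [mul_comm]
    rcases hp.mem_or_mem (hle hmem) with h2 | h2
    · exact hg (hp.mem_of_pow_mem _ h2)
    · obtain ⟨l', hl', hl''⟩ := Ideal.IsPrime.prod_mem_iff.1 h2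
      exact hy l' (Finset.ne_of_mem_erase hl') hl''

end Conclusion

section BaseLocus

variable {k : ℕ} {n : Fin k → ℕ} {a : Fin k → ℕ} {K : Type} [Field K] {s : ℕ}

/-- The coordinates of a point of the multiprojective space. -/
def MPPoint.coords (P : MPPoint K k n) : MPIdx k n → K := fun x => P.v x.1 x.2

theorem formIdeal_le_span_secI (T : Fin s → MPPoint K k n) :
    formIdeal a (fun l => (T l).coords) ≤
      Ideal.span (secI K k n (vanIdeal K k n (Set.range T)) a : Set (MPR K k n)) := by
  refine Ideal.span_mono ?_
  rintro w ⟨hw, hw0⟩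
  refine ⟨hw, ?_⟩
  rintro _ ⟨l, rfl⟩ lam
  have h := aeval_scale lam (T l).coords hw
  rw [aeval_eq_eval, aeval_eq_eval] at h
  exact h.trans (by rw [hw0, mul_zero])

theorem le_msat_of_chartMon_mem_radical (T : Fin s → MPPoint K k n) {f : MPR K k n}
    (h : ∀ g, chartMon K g ∈ ((formIdeal a fun l => (T l).coords).colon {f}).radical) :
    f ∈ msat K k n
      (Ideal.span (secI K k n (vanIdeal K k n (Set.range T)) a : Set (MPR K k n))) := by
  set R : Ideal (MPR K k n) := (formIdeal a fun l => (T l).coords).colon {f}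
  obtain ⟨N, hN⟩ := Ideal.exists_radical_pow_le_of_fg R (IsNoetherian.noetherian _)
  refine Ideal.subset_span ⟨N, fun g => formIdeal_le_span_secI T ?_⟩
  refine Submodule.mem_colon_singleton.1 (hN ?_)
  have h1 := Ideal.prod_mem_prod (s := Finset.univ) (I := fun _ : Fin N => R.radical)
    fun t _ => h (g t)
  rwa [Finset.prod_const, Finset.card_univ, Fintype.card_fin] at h1

theorem msat_le_vanIdeal [Infinite K] (T : Fin s → MPPoint K k n)
    (hT : ∀ l x, (T l).coords x ≠ 0) :
    msat K k n (Ideal.span (secI K k n (vanIdeal K k n (Set.range T)) a : Set (MPR K k n))) ≤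
      vanIdeal K k n (Set.range T) := by
  refine Ideal.span_le.2 ?_
  rintro f ⟨N, hN⟩
  have h1 := Ideal.span_le.2 (fun w hw => hw.2 :
    (secI K k n (vanIdeal K k n (Set.range T)) a : Set (MPR K k n)) ⊆
      vanIdeal K k n (Set.range T)) (hN fun _ _ => 0)
  rintro _ ⟨l, rfl⟩ lam
  let z : MPIdx k n → MvPolynomial (Fin k) K := fun x => X x.1 * C ((T l).coords x)
  have hz (lam : Fin k → K) (f : MPR K k n) :
      eval lam (aeval z f) = coneEval K k n lam (T l) f := by
    rw [aeval_def, eval₂_comp_left]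
    have h2 : (eval lam).comp (algebraMap K (MvPolynomial (Fin k) K)) = RingHom.id K := by
      ext
      simp
    rw [h2, eval₂_id]
    change eval _ f = eval _ f
    congr 2
    ext x
    simp [z, MPPoint.coords]
  have h2 : aeval z ((∏ t : Fin N, ∏ i : Fin k, X (⟨i, 0⟩ : MPIdx k n)) * f) = 0 := by
    refine MvPolynomial.funext fun lam => ?_
    rw [hz, map_zero]
    exact h1 _ ⟨l, rfl⟩ lam
  rw [map_mul] at h2
  rw [← hz, (mul_eq_zero.1 h2).resolve_left, map_zero]
  simp only [map_prod, aeval_X]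
  exact Finset.prod_ne_zero_iff.2 fun _ _ => Finset.prod_ne_zero_iff.2 fun i _ =>
    mul_ne_zero (X_ne_zero _) ((map_ne_zero_iff _ (C_injective _ _)).2 (hT l _))

theorem map_ell {A A' : Type} [CommRing A] [CommRing A'] (φ : A →+* A')
    (g : ∀ i, Fin (n i + 1)) (P : MPIdx k n → A) (y : MPIdx k n) :
    map φ (ell g P y) = ell g (φ ∘ P) y := by
  simp [ell]

theorem generic_minor_ne_zero (g : ∀ i, Fin (n i + 1)) (y : OffChart g) {l l' : Fin s}
    (hl : l ≠ l') :
    genPt K s n l ⟨y.1.1, g y.1.1⟩ * genPt K s n l' y.1 -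
      genPt K s n l y.1 * genPt K s n l' ⟨y.1.1, g y.1.1⟩ ≠ 0 := by
  classical
  intro h
  have hy : y.1 ≠ ⟨y.1.1, g y.1.1⟩ := fun h => y.2 (by rw [h])
  have h1 := congrArg (eval fun q : Fin s × MPIdx k n =>
    if q = (l, ⟨y.1.1, g y.1.1⟩) ∨ q = (l', y.1) then (1 : K) else 0) h
  simp [genPt, hl, hy] at h1

theorem genericPts_of_ne_zero (hk : 2 ≤ k) (hn : ∀ i, 1 ≤ n i) (ha : ∀ i, 0 < a i)
    [CharZero K] (hs0 : 0 < s) (hs : s + ∑ i, n i < ∏ i, Nat.choose (n i + a i) (n i)) :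
    GenericPts K k n s fun T => (∀ l x, (T l).coords x ≠ 0) ∧
      ∀ f ∈ vanIdeal K k n (Set.range T), ∀ g,
        chartMon K g ∈ ((formIdeal a fun l => (T l).coords).colon {f}).radical := by
  classical
  have hoff (g : ∀ i, Fin (n i + 1)) : Nonempty (OffChart g) := by
    let u : Fin k := ⟨0, by lia⟩
    have : Nontrivial (Fin (n u + 1)) := Fin.nontrivial_iff_two_le.2 (Nat.succ_le_succ (hn u))
    obtain ⟨j, hj⟩ := exists_ne (g u)
    exact ⟨⟨⟨u, j⟩, hj⟩⟩
  let y (g : ∀ i, Fin (n i + 1)) : OffChart g := Classical.arbitrary _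
  choose D hD N hDN using fun g y => exists_certificate (F := K) hk hn ha hs0 hs g y
  let minor (g : ∀ i, Fin (n i + 1)) (l l' : Fin s) : CoordRing K s n :=
    if l = l' then 1 else
      genPt K s n l ⟨(y g).1.1, g (y g).1.1⟩ * genPt K s n l' (y g).1 -
        genPt K s n l (y g).1 * genPt K s n l' ⟨(y g).1.1, g (y g).1.1⟩
  refine ⟨(∏ g, ∏ z, D g z) * (∏ l, ∏ x, genPt K s n l x) * ∏ g, ∏ l, ∏ l', minor g l l',
    ?_, fun T hT => ?_⟩
  · simp only [mul_ne_zero_iff, Finset.prod_ne_zero_iff]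
    refine ⟨⟨fun g _ z _ => hD g z, fun l _ x _ => X_ne_zero _⟩, fun g _ l _ l' _ => ?_⟩
    simp only [minor]
    split_ifs with h
    · exact one_ne_zero
    · exact generic_minor_ne_zero g _ h
  · simp only [map_mul, map_prod, mul_ne_zero_iff, Finset.prod_ne_zero_iff, Finset.mem_univ,
      true_imp_iff] at hT
    obtain ⟨⟨hTD, hTx⟩, hTm⟩ := hT
    set φ := eval fun q : Fin s × MPIdx k n => (T q.1).v q.2.1 q.2.2
    have hφ (l : Fin s) (x : MPIdx k n) : φ (genPt K s n l x) = (T l).coords x := eval_X _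
    have hφ' (l : Fin s) : φ ∘ genPt K s n l = (T l).coords := funext (hφ l)
    simp only [hφ] at hTx
    refine ⟨hTx, fun f hf g => chartMon_mem_radical_colon g hTx (fun l l' hl => ⟨y g, ?_⟩)
      (fun z => ⟨N g z, ?_⟩) fun l lam => hf _ ⟨l, rfl⟩ lam⟩
    · have h := hTm g l l'
      simp only [minor, if_neg hl, map_sub, map_mul, hφ] at h
      exact h
    · have h := map_mem_formIdeal φ _ (hDN g z)
      simp only [map_mul, map_pow, map_prod, map_C, map_ell, hφ', chartMon, map_X, mul_assoc] at h
      rwa [Ideal.unit_mul_mem_iff_mem _ ((isUnit_iff_ne_zero.2 (hTD g z)).map C)] at h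

end BaseLocus

end MultiProjPaper

namespace MultiProjPaper

/-- Proposition `f3`.
Let `X = ℙ^{n_1} × ⋯ × ℙ^{n_k}`, `k ≥ 2`, over an algebraically closed field `K` of
characteristic `0`. Fix `a ∈ ℕ^k` with all `a_i > 0` and an integer `s` with
`0 < s < ∏ C(n_i + a_i, n_i) - n_1 - ⋯ - n_k`. Let `Z ⊂ X` be a general subset of
cardinality `s`. Then `Z` equals the scheme-theoretic base locus of `|𝓘_Z(a)|`:
the saturation of the ideal generated by `H^0(𝓘_Z(a))` equals the saturated ideal of
`Z`. -/
theorem statement18 (K : Type) [Field K] [IsAlgClosed K] [CharZero K]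
    (k : ℕ) (hk : 2 ≤ k) (n : Fin k → ℕ) (hn : ∀ i, 1 ≤ n i)
    (a : Fin k → ℕ) (ha : ∀ i, 0 < a i) (s : ℕ) (hs : 0 < s)
    (hs' : s + ∑ i, n i < ∏ i, Nat.choose (n i + a i) (n i)) :
    GenericPts K k n s (fun T =>
      msat K k n
        (Ideal.span (↑(secI K k n (vanIdeal K k n (Set.range T)) a) : Set (MPR K k n))) =
      vanIdeal K k n (Set.range T)) := by
  obtain ⟨F, hF, h⟩ := genericPts_of_ne_zero (K := K) hk hn ha hs hs'
  refine ⟨F, hF, fun T hT => ?_⟩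
  obtain ⟨h1, h2⟩ := h T hT
  exact le_antisymm (msat_le_vanIdeal T h1) fun f hf => le_msat_of_chartMon_mem_radical T (h2 f hf)

end MultiProjPaper
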